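/- Let (X_t)_{t∈ℕ} be a 1-approximating functional with constants (a_k)_{k≥0} of a stationary absolutely regular time series, where Σ_{k=d}^∞ a_k < ∞ for some integer d ≥ 0. Let h : ℝ^{2d} → ℝ be a measurable, symmetric, 1-continuous kernel, and suppose the family {h(X_s, X_t) : s, t ≥ 1} is uniformly integrable. Then the U-statistic U_n(h) = (1/(n(n−1))) Σ_{1≤s≠t≤n} h(X_s, X_t) converges in probability to θ := ∫∫ h(x,y) dF(x) dF(y) as n → ∞, where F is the law of X_0. -/

import Mathlib

open MeasureTheory ProbabilityTheory Filter

noncomputable section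

/-- The σ-algebra 𝒜ₖˡ = σ(Z_k, …, Z_l). -/
def sigmaIcc {Ω : Type*} [MeasurableSpace Ω] (Z : ℤ → Ω → ℝ) (k l : ℤ) : MeasurableSpace Ω :=
  ⨆ i ∈ Set.Icc k l, MeasurableSpace.comap (Z i) inferInstance

/-- The σ-algebra 𝒜ₖ^∞ = σ(Z_k, Z_{k+1}, …). -/
def sigmaIci {Ω : Type*} [MeasurableSpace Ω] (Z : ℤ → Ω → ℝ) (k : ℤ) : MeasurableSpace Ω :=
  ⨆ i ∈ Set.Ici k, MeasurableSpace.comap (Z i) inferInstance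

/-- A stationary time series. -/
def Stationary {Ω : Type*} [MeasurableSpace Ω] (μ : Measure Ω) (Z : ℤ → Ω → ℝ) : Prop :=
  ∀ t : ℤ, Measure.map (fun ω => fun s : ℤ => Z (s + t) ω) μ
    = Measure.map (fun ω => fun s : ℤ => Z s ω) μ

/-- The absolute-regularity coefficient of two σ-algebras:
`sup Σ_i Σ_j |P(A_i ∩ B_j) − P(A_i)P(B_j)|` over all finite measurable partitions. -/
def betaCoeff {Ω : Type*} [MeasurableSpace Ω] (μ : Measure Ω)
    (m₁ m₂ : MeasurableSpace Ω) : ℝ :=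
  sSup {r : ℝ | ∃ (I J : ℕ) (A : Fin I → Set Ω) (B : Fin J → Set Ω),
    (∀ i, MeasurableSet[m₁] (A i)) ∧ (∀ j, MeasurableSet[m₂] (B j)) ∧
    Pairwise (Function.onFun Disjoint A) ∧ Pairwise (Function.onFun Disjoint B) ∧
    (⋃ i, A i) = Set.univ ∧ (⋃ j, B j) = Set.univ ∧
    r = ∑ i, ∑ j, |(μ (A i ∩ B j)).toReal - (μ (A i)).toReal * (μ (B j)).toReal|}

/-- The mixing coefficient `β_k = sup_n β(σ(Z_1,…,Z_n), σ(Z_{n+k},…))`. -/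
def betaMix {Ω : Type*} [MeasurableSpace Ω] (μ : Measure Ω) (Z : ℤ → Ω → ℝ) (k : ℕ) : ℝ :=
  sSup {r : ℝ | ∃ n : ℕ, 1 ≤ n ∧ r = betaCoeff μ (sigmaIcc Z 1 n) (sigmaIci Z (n + k))}


section coupling
variable {E : Type} [NormedAddCommGroup E] [MeasurableSpace E] [BorelSpace E]
  [SecondCountableTopology E]

set_option linter.unusedSectionVars false

open Classical in
/-- normalised cell weight -/
noncomputable def cellW (F : Measure E) (c : SimpleFunc E E) (u x : E) : ℝ :=
  if c u = c x then (F.real (c ⁻¹' {c u}))⁻¹ else 0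

lemma cellW_nonneg (F : Measure E) (c : SimpleFunc E E) (u x : E) : 0 ≤ cellW F c u x := by
  unfold cellW; split_ifs <;> positivity

lemma cellW_symm (F : Measure E) (c : SimpleFunc E E) (u x : E) :
    cellW F c u x = cellW F c x u := by
  unfold cellW
  by_cases hc : c u = c x
  · rw [if_pos hc, if_pos hc.symm, hc]
  · rw [if_neg hc, if_neg (Ne.symm hc)]

lemma cellW_eq_sum (F : Measure E) (c : SimpleFunc E E) (u x : E) :
    cellW F c u x = ∑ y ∈ c.range, (c ⁻¹' {y}).indicator (fun _ => (1 : ℝ)) u *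
      ((F.real (c ⁻¹' {y}))⁻¹ * (c ⁻¹' {y}).indicator (fun _ => (1 : ℝ)) x) := by
  rw [Finset.sum_eq_single (c u)]
  · by_cases hc : c u = c x
    · simp [cellW, hc]
    · simp [cellW, hc, Ne.symm hc]
  · intro y _ hy
    simp [Ne.symm hy]
  · intro hn
    exact absurd (c.mem_range_self u) hn

lemma cellW_measurable (F : Measure E) (c : SimpleFunc E E) :
    Measurable (fun q : E × E => cellW F c q.1 q.2) := by
  simp_rw [cellW_eq_sum]
  have hm : ∀ y, Measurable ((c ⁻¹' {y}).indicator (fun _ => (1 : ℝ))) := fun y =>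
    measurable_const.indicator (c.measurableSet_preimage _)
  refine Finset.measurable_sum _ fun y _ => ?_
  exact ((hm y).comp measurable_fst).mul (((hm y).comp measurable_snd).const_mul _)

lemma cellW_bdd (F : Measure E) (c : SimpleFunc E E) :
    ∃ M : ℝ, 0 ≤ M ∧ ∀ u x, cellW F c u x ≤ M := by
  refine ⟨∑ y ∈ c.range, (F.real (c ⁻¹' {y}))⁻¹, by positivity, fun u x => ?_⟩
  rw [cellW_eq_sum]
  refine Finset.sum_le_sum fun y _ => ?_
  have h0 : 0 ≤ (F.real (c ⁻¹' {y}))⁻¹ := by positivity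
  by_cases h1 : u ∈ (c ⁻¹' {y}) <;> by_cases h2 : x ∈ (c ⁻¹' {y}) <;> simp_all

lemma cellW_pos_ae (F : Measure E) [IsProbabilityMeasure F] (c : SimpleFunc E E) :
    ∀ᵐ u ∂F, F.real (c ⁻¹' {c u}) ≠ 0 := by
  have : ∀ y ∈ c.range, ∀ᵐ u ∂F, c u = y → F.real (c ⁻¹' {c u}) ≠ 0 := by
    intro y _
    by_cases hy : F.real (c ⁻¹' {y}) = 0
    · have h0 : F (c ⁻¹' {y}) = 0 := by
        simpa [Measure.real, ENNReal.toReal_eq_zero_iff] using hy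
      have := measure_eq_zero_iff_ae_notMem.1 h0
      filter_upwards [this] with u hu hcu
      exact absurd hcu hu
    · filter_upwards with u hu
      rwa [hu]
  have := (Finset.eventually_all c.range).2 this
  filter_upwards [this] with u hu
  exact hu _ (c.mem_range_self u) rfl

lemma cellW_integral (F : Measure E) [IsProbabilityMeasure F] (c : SimpleFunc E E) :
    ∀ᵐ u ∂F, ∫ x, cellW F c u x ∂F = 1 := by
  filter_upwards [cellW_pos_ae F c] with u hu
  have : (fun x => cellW F c u x)
      = (c ⁻¹' {c u}).indicator (fun _ => (F.real (c ⁻¹' {c u}))⁻¹) := by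
    ext x
    by_cases hc : c u = c x
    · simp [cellW, hc]
    · simp [cellW, hc, Ne.symm hc]
  rw [this, integral_indicator (c.measurableSet_preimage _)]
  simp [hu]

lemma coupling_bound (F : Measure E) [IsProbabilityMeasure F] (ν : Measure (E × E))
    [IsProbabilityMeasure ν] (hν1 : ν.map Prod.fst = F) (hν2 : ν.map Prod.snd = F)
    (h : E → E → ℝ) (hh : Measurable (fun p : E × E => h p.1 p.2)) (B ε : ℝ)
    (c : SimpleFunc E E)
    (hcont : ∀ (m : Measure ((E × E) × (E × E))) (_ : IsProbabilityMeasure m)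
      (U Ut V : (E × E) × (E × E) → E), Measurable U → Measurable Ut → Measurable V →
      m.map U = F → m.map Ut = F → m.map V = F → m.map (fun ω => (U ω, V ω)) = ν →
      ∫ ω, |h (U ω) (V ω) - h (Ut ω) (V ω)|
              * (if ‖U ω - Ut ω‖ ≤ ε then (1 : ℝ) else 0) ∂m ≤ B)
    (ψ : ℝ → ℝ) (hψ : ∀ x y, |ψ x - ψ y| ≤ |x - y|) (K : ℝ) (hK : ∀ x, |ψ x| ≤ K) :
    ∫ p, |ψ (h p.1 p.2) - ∫ x, cellW F c p.1 x * ψ (h x p.2) ∂F| ∂ν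
      ≤ B + 4 * K * F.real {x | ε / 2 < ‖c x - x‖} := by
  have hψm : Measurable ψ := by
    have : LipschitzWith 1 ψ := LipschitzWith.of_dist_le_mul fun x y => by
      simpa [Real.dist_eq] using hψ x y
    exact this.continuous.measurable
  have hK0 : 0 ≤ K := (abs_nonneg _).trans (hK 0)
  obtain ⟨M, hM0, hM⟩ := cellW_bdd F c
  have hWm := cellW_measurable F c
  set w : (E × E) × (E × E) → ℝ := fun q => cellW F c q.1.1 q.2.1 with hw
  have hwm : Measurable w :=
    hWm.comp ((measurable_fst.comp measurable_fst).prodMk (measurable_fst.comp measurable_snd))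
  have hw0 : ∀ q, 0 ≤ w q := fun q => cellW_nonneg _ _ _ _
  have hwM : ∀ q, w q ≤ M := fun q => hM _ _
  set m : Measure ((E × E) × (E × E)) :=
    (ν.prod ν).withDensity (fun q => ENNReal.ofReal (w q)) with hm
  have hfstint : ∀ G : E → ℝ, Measurable G → ∫ x, G x ∂F = ∫ p, G p.1 ∂ν := by
    intro G hG
    calc ∫ x, G x ∂F = ∫ x, G x ∂(ν.map Prod.fst) := by rw [hν1]
      _ = _ := integral_map measurable_fst.aemeasurable hG.aestronglyMeasurable
  -- integral of weight
  have hw1 : ∀ᵐ p ∂ν, ∫ p', w (p, p') ∂ν = 1 := by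
    have h1 := cellW_integral F c
    have h2 : ∀ᵐ p ∂ν, ∫ x, cellW F c p.1 x ∂F = 1 :=
      ae_of_ae_map measurable_fst.aemeasurable (by rw [hν1]; exact h1)
    filter_upwards [h2] with p hp
    rw [← hp, hfstint (fun x => cellW F c p.1 x) (hWm.comp measurable_prodMk_left)]
  have hwint : ∀ p, Integrable (fun p' => w (p, p')) ν := fun p =>
    Integrable.of_bound (hwm.comp measurable_prodMk_left).aestronglyMeasurable M
      (ae_of_all _ fun p' => by
        rw [Real.norm_eq_abs, abs_of_nonneg (hw0 _)]; exact hwM _)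
  have hwl : ∀ᵐ p ∂ν, ∫⁻ p', ENNReal.ofReal (w (p, p')) ∂ν = 1 := by
    filter_upwards [hw1] with p hp
    rw [← ofReal_integral_eq_lintegral_ofReal (hwint p) (ae_of_all _ fun _ => hw0 _), hp]
    simp
  have hmfst : m.map Prod.fst = ν := by
    ext A hA
    rw [Measure.map_apply measurable_fst hA, hm, withDensity_apply _ (measurable_fst hA),
      ← lintegral_indicator (measurable_fst hA), lintegral_prod]
    · have : ∀ᵐ p ∂ν, ∫⁻ p', (Prod.fst ⁻¹' A).indicator
          (fun q : (E × E) × (E × E) => ENNReal.ofReal (w q)) (p, p') ∂ν = A.indicator 1 p := by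
        filter_upwards [hwl] with p hp
        by_cases hpA : p ∈ A
        · simpa [hpA, Set.indicator] using hp
        · simp [hpA, Set.indicator]
      rw [lintegral_congr_ae this, lintegral_indicator_one hA]
    · exact (hwm.ennreal_ofReal.indicator (measurable_fst hA)).aemeasurable
  have hmswap : m.map Prod.swap = m := by
    ext A hA
    rw [Measure.map_apply measurable_swap hA, hm, withDensity_apply _ (measurable_swap hA),
      withDensity_apply _ hA]
    conv_rhs => rw [← Measure.prod_swap, setLIntegral_map hA hwm.ennreal_ofReal measurable_swap]
    refine lintegral_congr fun q => ?_
    rw [hw]; simp only [Prod.fst_swap, Prod.snd_swap]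
    rw [cellW_symm]
  have hmprob : IsProbabilityMeasure m := by
    constructor
    have := congrArg (fun μ => μ Set.univ) hmfst
    rw [Measure.map_apply measurable_fst MeasurableSet.univ] at this
    simpa using this
  have hmU : m.map (fun q => q.1.1) = F := by
    rw [← hν1, ← hmfst, Measure.map_map measurable_fst measurable_fst]; rfl
  have hmV : m.map (fun q => q.1.2) = F := by
    rw [← hν2, ← hmfst, Measure.map_map measurable_snd measurable_fst]; rfl
  have hmU' : m.map (fun q => q.2.1) = F := by
    conv_lhs => rw [← hmswap]
    rw [Measure.map_map (by fun_prop) measurable_swap]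
    exact hmU
  -- the difference functions
  set D : (E × E) × (E × E) → ℝ := fun q => |h q.1.1 q.1.2 - h q.2.1 q.1.2| with hD
  set Dp : (E × E) × (E × E) → ℝ := fun q => |ψ (h q.1.1 q.1.2) - ψ (h q.2.1 q.1.2)| with hDp
  have hm1 : Measurable (fun q : (E × E) × (E × E) => h q.1.1 q.1.2) := hh.comp measurable_fst
  have hm2 : Measurable (fun q : (E × E) × (E × E) => h q.2.1 q.1.2) :=
    hh.comp ((measurable_fst.comp measurable_snd).prodMk (measurable_snd.comp measurable_fst))
  have hDm : Measurable D := by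
    simpa [hD, Real.norm_eq_abs] using (hm1.sub hm2).norm
  have hDpm : Measurable Dp := by
    simpa [hDp, Real.norm_eq_abs] using ((hψm.comp hm1).sub (hψm.comp hm2)).norm
  have hDp0 : ∀ q, 0 ≤ Dp q := fun q => abs_nonneg _
  have hDpK : ∀ q, Dp q ≤ 2 * K := fun q => by
    have := abs_sub (ψ (h q.1.1 q.1.2)) (ψ (h q.2.1 q.1.2))
    have h1 := hK (h q.1.1 q.1.2)
    have h2 := hK (h q.2.1 q.1.2)
    simp only [hDp]; linarith
  have hDpD : ∀ q, Dp q ≤ D q := fun q => hψ _ _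
  set cl : (E × E) × (E × E) → ℝ := fun q => if ‖q.1.1 - q.2.1‖ ≤ ε then (1 : ℝ) else 0 with hcl
  have hclset : MeasurableSet {q : (E × E) × (E × E) | ‖q.1.1 - q.2.1‖ ≤ ε} :=
    measurableSet_le (by fun_prop) measurable_const
  have hclm : Measurable cl := Measurable.ite hclset measurable_const measurable_const
  have hcl0 : ∀ q, 0 ≤ cl q := fun q => by simp only [hcl]; split_ifs <;> norm_num
  have hcl1 : ∀ q, cl q ≤ 1 := fun q => by simp only [hcl]; split_ifs <;> norm_num
  let S : ℕ → Set ((E × E) × (E × E)) := fun L => {q | D q ≤ L ∧ D q.swap ≤ L}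
  have hSm : ∀ L, MeasurableSet (S L) := fun L =>
    (measurableSet_le hDm measurable_const).inter
      (measurableSet_le (hDm.comp measurable_swap) measurable_const)
  have hSswap : ∀ L, Prod.swap ⁻¹' (S L) = S L := fun L => by
    ext q; simp [S, and_comm]
  have hbound : ∀ L, ∫ q, (S L).indicator (fun q => D q * cl q) q ∂m ≤ B := by
    intro L
    classical
    let Ut : (E × E) × (E × E) → E := fun q => if q ∈ S L then q.2.1 else q.1.1
    have hUtm : Measurable Ut := Measurable.ite (hSm L) (by fun_prop) (by fun_prop)
    have hUt : m.map Ut = F := by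
      ext A hA
      rw [Measure.map_apply hUtm hA]
      have e1 : m (Ut ⁻¹' A) = m (Ut ⁻¹' A ∩ S L) + m (Ut ⁻¹' A \ S L) :=
        (measure_inter_add_sdiff _ (hSm L)).symm
      have e2 : Ut ⁻¹' A ∩ S L = Prod.swap ⁻¹' ((fun q => q.1.1) ⁻¹' A ∩ S L) := by
        rw [Set.preimage_inter, hSswap]
        ext q
        simp only [Set.mem_inter_iff, Set.mem_preimage, Ut, and_congr_left_iff]
        intro hq
        simp [hq]
      have e3 : Ut ⁻¹' A \ S L = (fun q => q.1.1) ⁻¹' A \ S L := by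
        ext q
        simp only [Set.mem_sdiff, Set.mem_preimage, Ut, and_congr_left_iff]
        intro hq
        simp [hq]
      have hAm : MeasurableSet ((fun q : (E × E) × (E × E) => q.1.1) ⁻¹' A) :=
        (measurable_fst.comp measurable_fst) hA
      rw [e1, e2, e3, ← Measure.map_apply measurable_swap (hAm.inter (hSm L)), hmswap,
        measure_inter_add_sdiff _ (hSm L), ← Measure.map_apply (by fun_prop) hA, hmU]
    have := hcont m hmprob (fun q => q.1.1) Ut (fun q => q.1.2) (by fun_prop) hUtm (by fun_prop)
      hmU hUt hmV hmfst
    refine le_trans (le_of_eq (integral_congr_ae (ae_of_all _ fun q => ?_))) this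
    by_cases hq : q ∈ S L
    · simp [hq, Ut, D, cl]
    · simp [hq, Ut]
  have hbound2 : ∀ L, ∫ q, (S L).indicator (fun q => Dp q * cl q) q ∂m ≤ B := by
    intro L
    refine le_trans (integral_mono_of_nonneg (ae_of_all _ fun q => ?_) ?_
      (ae_of_all _ fun q => ?_)) (hbound L)
    · exact Set.indicator_nonneg (fun q _ => mul_nonneg (hDp0 q) (hcl0 q)) q
    · refine Integrable.of_bound (((hDm.mul hclm).indicator (hSm L)).aestronglyMeasurable) L
        (ae_of_all _ fun q => ?_)
      by_cases hq : q ∈ S L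
      · simp only [hq, Set.indicator_of_mem, norm_mul, Real.norm_eq_abs]
        have h1 : D q ≤ L := hq.1
        have h2 : 0 ≤ D q := abs_nonneg _
        rw [abs_of_nonneg h2, abs_of_nonneg (hcl0 q)]
        calc D q * cl q ≤ D q * 1 := mul_le_mul_of_nonneg_left (hcl1 q) h2
          _ ≤ L := by linarith
      · simp [hq]
    · exact Set.indicator_le_indicator (mul_le_mul_of_nonneg_right (hDpD q) (hcl0 q))
  have hlim : Tendsto (fun L => ∫ q, (S L).indicator (fun q => Dp q * cl q) q ∂m) atTop
      (nhds (∫ q, Dp q * cl q ∂m)) := by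
    refine tendsto_integral_of_dominated_convergence (fun _ => 2 * K) ?_
      (integrable_const _) ?_ ?_
    · intro L; exact ((hDpm.mul hclm).indicator (hSm L)).aestronglyMeasurable
    · intro L
      refine ae_of_all _ fun q => ?_
      refine (norm_indicator_le_norm_self _ _).trans ?_
      rw [norm_mul, Real.norm_eq_abs, Real.norm_eq_abs, abs_of_nonneg (hDp0 q),
        abs_of_nonneg (hcl0 q)]
      calc Dp q * cl q ≤ Dp q * 1 := mul_le_mul_of_nonneg_left (hcl1 q) (hDp0 q)
          _ ≤ 2 * K := by linarith [hDpK q]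
    · refine ae_of_all _ fun q => ?_
      obtain ⟨L0, hL0⟩ := exists_nat_ge (max (D q) (D q.swap))
      refine tendsto_const_nhds.congr' ?_
      filter_upwards [eventually_ge_atTop L0] with L hL
      have hL' : (L0 : ℝ) ≤ L := by exact_mod_cast hL
      have : q ∈ S L := ⟨(le_max_left _ _).trans (hL0.trans hL'),
        (le_max_right _ _).trans (hL0.trans hL')⟩
      simp [this]
  have hclose : ∫ q, Dp q * cl q ∂m ≤ B := le_of_tendsto' hlim hbound2
  -- far part
  set far : Set E := {x | ε / 2 < ‖c x - x‖} with hfar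
  have hfarm : MeasurableSet far :=
    measurableSet_lt measurable_const (c.measurable.sub measurable_id).norm
  have hcell : ∀ᵐ q ∂m, c q.1.1 = c q.2.1 := by
    rw [hm, ae_withDensity_iff hwm.ennreal_ofReal]
    refine ae_of_all _ fun q hq => ?_
    by_contra hne
    apply hq
    simp [hw, cellW, hne]
  have hDpi : Integrable Dp m := Integrable.of_bound hDpm.aestronglyMeasurable (2 * K)
    (ae_of_all _ fun q => by rw [Real.norm_eq_abs, abs_of_nonneg (hDp0 q)]; exact hDpK q)
  have hDpcli : Integrable (fun q => Dp q * cl q) m :=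
    Integrable.of_bound (hDpm.mul hclm).aestronglyMeasurable (2 * K)
    (ae_of_all _ fun q => by
      rw [Real.norm_eq_abs, abs_of_nonneg (mul_nonneg (hDp0 q) (hcl0 q))]
      calc Dp q * cl q ≤ Dp q * 1 := mul_le_mul_of_nonneg_left (hcl1 q) (hDp0 q)
          _ ≤ 2 * K := by linarith [hDpK q])
  let f1 : E → ℝ := far.indicator (fun _ => 2 * K)
  have hf1m : Measurable f1 := measurable_const.indicator hfarm
  have hf1i : Integrable f1 F := (integrable_const _).indicator hfarm
  have hf1int : ∫ x, f1 x ∂F = 2 * K * F.real far := by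
    simp only [f1]
    rw [integral_indicator hfarm]; simp [mul_comm]
  have hfU : Integrable (fun q : (E × E) × (E × E) => f1 q.1.1) m := by
    have : Integrable f1 (m.map (fun q => q.1.1)) := by rw [hmU]; exact hf1i
    exact this.comp_measurable (by fun_prop)
  have hfU' : Integrable (fun q : (E × E) × (E × E) => f1 q.2.1) m := by
    have : Integrable f1 (m.map (fun q => q.2.1)) := by rw [hmU']; exact hf1i
    exact this.comp_measurable (by fun_prop)
  have hiU : ∫ q, f1 q.1.1 ∂m = 2 * K * F.real far := by
    rw [← hf1int, ← hmU, integral_map (by fun_prop) hf1m.aestronglyMeasurable]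
  have hiU' : ∫ q, f1 q.2.1 ∂m = 2 * K * F.real far := by
    rw [← hf1int, ← hmU', integral_map (by fun_prop) hf1m.aestronglyMeasurable]
  have hDple : ∫ q, Dp q ∂m ≤ B + 4 * K * F.real far := by
    have : ∫ q, Dp q ∂m ≤ ∫ q, (Dp q * cl q + (f1 q.1.1 + f1 q.2.1)) ∂m := by
      refine integral_mono_ae hDpi (hDpcli.add (hfU.add hfU')) ?_
      filter_upwards [hcell] with q hq
      have hf0 : ∀ x, 0 ≤ f1 x := fun x => Set.indicator_nonneg (fun _ _ => by positivity) x
      by_cases hcq : ‖q.1.1 - q.2.1‖ ≤ ε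
      · simp only [hcl, hcq, if_true, mul_one]
        linarith [hf0 q.1.1, hf0 q.2.1]
      · simp only [hcl, hcq, if_false, mul_zero, zero_add]
        have : q.1.1 ∈ far ∨ q.2.1 ∈ far := by
          by_contra hno
          push Not at hno
          have h1 : ‖c q.1.1 - q.1.1‖ ≤ ε / 2 := not_lt.1 hno.1
          have h2 : ‖c q.2.1 - q.2.1‖ ≤ ε / 2 := not_lt.1 hno.2
          apply hcq
          have : q.1.1 - q.2.1 = (c q.2.1 - q.2.1) - (c q.1.1 - q.1.1) := by rw [hq]; abel
          rw [this]
          exact (norm_sub_le _ _).trans (by linarith)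
        rcases this with hx | hx
        · have : f1 q.1.1 = 2 * K := by simp [f1, hx]
          linarith [hDpK q, hf0 q.2.1]
        · have : f1 q.2.1 = 2 * K := by simp [f1, hx]
          linarith [hDpK q, hf0 q.1.1]
    refine this.trans ?_
    have hadd : Integrable (fun q : (E × E) × (E × E) => f1 q.1.1 + f1 q.2.1) m := hfU.add hfU'
    rw [integral_add hDpcli hadd, integral_add hfU hfU', hiU, hiU']
    linarith
  refine le_trans ?_ hDple
  -- Jensen
  have hDpw : ∫ q, Dp q ∂m = ∫ p, ∫ p', w (p, p') * Dp (p, p') ∂ν ∂ν := by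
    rw [hm, integral_withDensity_eq_integral_toReal_smul hwm.ennreal_ofReal
      (ae_of_all _ fun _ => ENNReal.ofReal_lt_top)]
    have : (fun q => (ENNReal.ofReal (w q)).toReal • Dp q) = fun q => w q * Dp q := by
      ext q; rw [ENNReal.toReal_ofReal (hw0 q), smul_eq_mul]
    rw [this, integral_prod]
    refine Integrable.of_bound (hwm.mul hDpm).aestronglyMeasurable (M * (2 * K))
      (ae_of_all _ fun q => ?_)
    rw [Real.norm_eq_abs, abs_of_nonneg (mul_nonneg (hw0 q) (hDp0 q))]
    exact mul_le_mul (hwM q) (hDpK q) (hDp0 q) hM0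
  rw [hDpw]
  have hwDi : Integrable (fun q => w q * Dp q) (ν.prod ν) := by
    refine Integrable.of_bound (hwm.mul hDpm).aestronglyMeasurable (M * (2 * K))
      (ae_of_all _ fun q => ?_)
    rw [Real.norm_eq_abs, abs_of_nonneg (mul_nonneg (hw0 q) (hDp0 q))]
    exact mul_le_mul (hwM q) (hDpK q) (hDp0 q) hM0
  refine integral_mono_of_nonneg (ae_of_all _ fun _ => abs_nonneg _) hwDi.integral_prod_left ?_
  filter_upwards [hw1] with p hp
  have hx : ∫ x, cellW F c p.1 x * ψ (h x p.2) ∂F = ∫ p', w (p, p') * ψ (h p'.1 p.2) ∂ν :=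
    hfstint (fun x => cellW F c p.1 x * ψ (h x p.2)) ((hWm.comp measurable_prodMk_left).mul
        (hψm.comp (hh.comp measurable_prodMk_right)))
  have hint2 : Integrable (fun p' : E × E => w (p, p') * ψ (h p'.1 p.2)) ν := by
    refine Integrable.of_bound ((hwm.comp measurable_prodMk_left).mul
      (hψm.comp (hh.comp (measurable_fst.prodMk measurable_const)))).aestronglyMeasurable (M * K)
      (ae_of_all _ fun p' => ?_)
    rw [norm_mul, Real.norm_eq_abs, Real.norm_eq_abs, abs_of_nonneg (hw0 _)]
    exact mul_le_mul (hwM _) (hK _) (abs_nonneg _) hM0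
  have : ψ (h p.1 p.2) - ∫ x, cellW F c p.1 x * ψ (h x p.2) ∂F
      = ∫ p', w (p, p') * (ψ (h p.1 p.2) - ψ (h p'.1 p.2)) ∂ν := by
    simp_rw [mul_sub]
    rw [integral_sub ((hwint p).mul_const _) hint2, hx, integral_mul_const, hp, one_mul]
  rw [this]
  refine (abs_integral_le_integral_abs).trans (le_of_eq ?_)
  refine integral_congr_ae (ae_of_all _ fun p' => ?_)
  simp only [abs_mul, abs_of_nonneg (hw0 _), hDp]

end coupling

section ulln
set_option linter.unusedSectionVars false

/-- uniform weak law of large numbers over sub-collections of indices -/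
def ULLN {Ω : Type*} [MeasurableSpace Ω] (μ : Measure Ω) (Y : ℕ → Ω → ℝ) (e : ℝ) : Prop :=
  ∀ δ : ℝ, 0 < δ → ∃ N : ℕ, ∀ n, N ≤ n → ∀ A ⊆ Finset.Icc 1 n,
    ∫ ω, |∑ t ∈ A, (Y t ω - e)| ∂μ ≤ δ * n

lemma card_near (T n s : ℕ) :
    ∑ t ∈ Finset.Icc 1 n, (if s < t + T ∧ t < s + T then (1 : ℝ) else 0) ≤ 2 * T := by
  rw [← Finset.sum_filter, Finset.sum_const, nsmul_eq_mul, mul_one]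
  have : ((Finset.Icc 1 n).filter (fun t => s < t + T ∧ t < s + T)).card
      ≤ (Finset.Ico (s + 1 - T) (s + T)).card := by
    apply Finset.card_le_card
    intro t ht
    simp only [Finset.mem_filter, Finset.mem_Icc, Finset.mem_Ico] at *
    omega
  rw [Nat.card_Ico] at this
  have h2 : ((Finset.Icc 1 n).filter (fun t => s < t + T ∧ t < s + T)).card ≤ 2 * T := by omega
  exact_mod_cast h2

lemma ulln_of_cov {Ω : Type*} [MeasurableSpace Ω] (μ : Measure Ω) [IsProbabilityMeasure μ]
    (G : ℕ → Set Ω) (hG : ∀ t, MeasurableSet (G t)) (p : ℝ) (hp : ∀ t, μ.real (G t) = p)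
    (hcov : ∀ δ : ℝ, 0 < δ → ∃ T : ℕ, ∀ s t, s + T ≤ t → |μ.real (G s ∩ G t) - p * p| ≤ δ) :
    ULLN μ (fun t => (G t).indicator (fun _ => (1 : ℝ))) p := by
  intro δ hδ
  obtain ⟨T, hT⟩ := hcov (δ ^ 2 / 2) (by positivity)
  obtain ⟨N, hN⟩ := exists_nat_ge (4 * T / δ ^ 2)
  refine ⟨N + 1, fun n hn A hA => ?_⟩
  have hp0 : 0 ≤ p := by rw [← hp 0]; exact measureReal_nonneg
  have hp1 : p ≤ 1 := by rw [← hp 0]; exact measureReal_le_one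
  have hn0 : (0 : ℝ) < n := by exact_mod_cast (by omega : 0 < n)
  have hnN : 4 * T / δ ^ 2 ≤ n := hN.trans (by exact_mod_cast (by omega : N ≤ n))
  have hnN' : 4 * T ≤ n * δ ^ 2 := by rwa [div_le_iff₀ (by positivity)] at hnN
  set y : ℕ → Ω → ℝ := fun t => (G t).indicator (fun _ => (1 : ℝ)) with hy
  have hyi : ∀ t, Integrable (y t) μ := fun t => (integrable_const _).indicator (hG t)
  have hyint : ∀ t, ∫ ω, y t ω ∂μ = p := fun t => by
    simp only [hy]; rw [integral_indicator (hG t)]; simp [hp]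
  have hyy : ∀ s t, (fun ω => y s ω * y t ω) = (G s ∩ G t).indicator (fun _ => (1 : ℝ)) := by
    intro s t
    ext ω
    by_cases h1 : ω ∈ G s <;> by_cases h2 : ω ∈ G t <;> simp [hy, h1, h2]
  have hyyi : ∀ s t, Integrable (fun ω => y s ω * y t ω) μ := fun s t => by
    rw [hyy]; exact (integrable_const _).indicator ((hG s).inter (hG t))
  have hyyint : ∀ s t, ∫ ω, y s ω * y t ω ∂μ = μ.real (G s ∩ G t) := fun s t => by
    rw [hyy, integral_indicator ((hG s).inter (hG t))]; simp
  have hexp : ∀ s t, (fun ω => (y s ω - p) * (y t ω - p))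
      = fun ω => (y s ω * y t ω - p * y s ω) - (p * y t ω - p * p) := by
    intro s t; ext ω; ring
  have hci : ∀ s t, Integrable (fun ω => (y s ω - p) * (y t ω - p)) μ := fun s t => by
    rw [hexp]
    exact ((hyyi s t).sub ((hyi s).const_mul p)).sub (((hyi t).const_mul p).sub (integrable_const _))
  have hc : ∀ s t, ∫ ω, (y s ω - p) * (y t ω - p) ∂μ = μ.real (G s ∩ G t) - p * p := by
    intro s t
    have i1 : Integrable (fun ω => y s ω * y t ω - p * y s ω) μ :=
      (hyyi s t).sub ((hyi s).const_mul p)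
    have i2 : Integrable (fun ω => p * y t ω - p * p) μ :=
      ((hyi t).const_mul p).sub (integrable_const _)
    rw [hexp, integral_sub i1 i2,
      integral_sub (hyyi s t) ((hyi s).const_mul p),
      integral_sub ((hyi t).const_mul p) (integrable_const _), integral_const_mul,
      integral_const_mul, hyint, hyint, hyyint]
    simp
  set Sg : Ω → ℝ := fun ω => ∑ t ∈ A, (y t ω - p) with hSg
  have hSq : ∀ ω, Sg ω ^ 2 = ∑ s ∈ A, ∑ t ∈ A, (y s ω - p) * (y t ω - p) := by
    intro ω; rw [pow_two, hSg, Finset.sum_mul_sum]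
  have hSqi : Integrable (fun ω => Sg ω ^ 2) μ := by
    simp_rw [hSq]
    exact integrable_finsetSum _ fun s _ => integrable_finsetSum _ fun t _ => hci s t
  have hb : ∀ s t, μ.real (G s ∩ G t) - p * p
      ≤ δ ^ 2 / 2 + (if s < t + T ∧ t < s + T then (1 : ℝ) else 0) := by
    intro s t
    split_ifs with hst
    · have : μ.real (G s ∩ G t) ≤ 1 := measureReal_le_one
      nlinarith [mul_nonneg hp0 hp0, sq_nonneg δ]
    · have : s + T ≤ t ∨ t + T ≤ s := by omega
      rcases this with h1 | h1
      · have := (abs_le.1 (hT s t h1)).2; linarith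
      · have := (abs_le.1 (hT t s h1)).2
        rw [Set.inter_comm] at this; linarith
  have hSqint : ∫ ω, Sg ω ^ 2 ∂μ ≤ (δ * n) ^ 2 := by
    simp_rw [hSq]
    rw [integral_finsetSum _ fun s _ => integrable_finsetSum _ fun t _ => hci s t]
    calc ∑ s ∈ A, ∫ ω, ∑ t ∈ A, (y s ω - p) * (y t ω - p) ∂μ
        = ∑ s ∈ A, ∑ t ∈ A, (μ.real (G s ∩ G t) - p * p) := by
          refine Finset.sum_congr rfl fun s _ => ?_
          rw [integral_finsetSum _ fun t _ => hci s t]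
          exact Finset.sum_congr rfl fun t _ => hc s t
      _ ≤ ∑ s ∈ A, ∑ t ∈ A,
            (δ ^ 2 / 2 + (if s < t + T ∧ t < s + T then (1 : ℝ) else 0)) :=
          Finset.sum_le_sum fun s _ => Finset.sum_le_sum fun t _ => hb s t
      _ ≤ ∑ s ∈ Finset.Icc 1 n, ∑ t ∈ Finset.Icc 1 n,
            (δ ^ 2 / 2 + (if s < t + T ∧ t < s + T then (1 : ℝ) else 0)) := by
          have hpos : ∀ s t : ℕ,
              0 ≤ (δ ^ 2 / 2 + (if s < t + T ∧ t < s + T then (1 : ℝ) else 0)) := by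
            intro s t; split_ifs <;> positivity
          refine (Finset.sum_le_sum_of_subset_of_nonneg hA fun s _ _ =>
            Finset.sum_nonneg fun t _ => hpos s t).trans ?_
          exact Finset.sum_le_sum fun s _ =>
            Finset.sum_le_sum_of_subset_of_nonneg hA fun t _ _ => hpos s t
      _ ≤ ∑ s ∈ Finset.Icc 1 n, (n * (δ ^ 2 / 2) + 2 * T) := by
          refine Finset.sum_le_sum fun s _ => ?_
          rw [Finset.sum_add_distrib]
          have := card_near T n s
          simp only [Finset.sum_const, Nat.card_Icc, nsmul_eq_mul, Nat.add_sub_cancel]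
          linarith
      _ = n * (n * (δ ^ 2 / 2) + 2 * T) := by simp; ring
      _ ≤ (δ * n) ^ 2 := by nlinarith
  have ha : 0 < δ * n := by positivity
  have hpt : ∀ ω, |Sg ω| ≤ Sg ω ^ 2 / (2 * (δ * n)) + δ * n / 2 := by
    intro ω
    have h1 := sq_nonneg (|Sg ω| - δ * n)
    have h2 := sq_abs (Sg ω)
    have : Sg ω ^ 2 / (2 * (δ * n)) + δ * n / 2 = (Sg ω ^ 2 + (δ * n) ^ 2) / (2 * (δ * n)) := by
      field_simp
    rw [this, le_div_iff₀ (by positivity)]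
    nlinarith
  calc ∫ ω, |Sg ω| ∂μ ≤ ∫ ω, (Sg ω ^ 2 / (2 * (δ * n)) + δ * n / 2) ∂μ :=
        integral_mono_of_nonneg (ae_of_all _ fun _ => abs_nonneg _)
          ((hSqi.div_const _).add (integrable_const _)) (ae_of_all _ hpt)
    _ = (∫ ω, Sg ω ^ 2 ∂μ) / (2 * (δ * n)) + δ * n / 2 := by
        rw [integral_add (hSqi.div_const _) (integrable_const _), integral_div]; simp
    _ ≤ (δ * n) ^ 2 / (2 * (δ * n)) + δ * n / 2 := by gcongr
    _ = δ * n := by field_simp; ring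

variable {Ω P : Type*} [MeasurableSpace Ω] [MeasurableSpace P] (μ : Measure Ω)
  [IsProbabilityMeasure μ] (Q : Measure P) [IsProbabilityMeasure Q]
  (W : ℕ → Ω → P) (hW : ∀ t, Measurable (W t)) (hQ : ∀ t, μ.map (W t) = Q)

/-- ULLN for functionals. -/
def FLLN (b : P → ℝ) : Prop := ULLN μ (fun t ω => b (W t ω)) (∫ x, b x ∂Q)

variable {μ Q W}

lemma comp_integrable (hW : ∀ t, Measurable (W t)) (hQ : ∀ t, μ.map (W t) = Q) {b : P → ℝ}
    (hb : Integrable b Q) (t : ℕ) : Integrable (fun ω => b (W t ω)) μ := by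
  rw [← hQ t] at hb
  exact hb.comp_measurable (hW t)

lemma comp_integral (hW : ∀ t, Measurable (W t)) (hQ : ∀ t, μ.map (W t) = Q) {b : P → ℝ}
    (hb : Integrable b Q) (t : ℕ) : ∫ ω, b (W t ω) ∂μ = ∫ x, b x ∂Q := by
  have h1 : AEStronglyMeasurable b (μ.map (W t)) := by rw [hQ t]; exact hb.1
  rw [← integral_map (hW t).aemeasurable h1, hQ t]

lemma sum_integrable (hW : ∀ t, Measurable (W t)) (hQ : ∀ t, μ.map (W t) = Q) {b : P → ℝ}
    (hb : Integrable b Q) (e : ℝ) (A : Finset ℕ) :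
    Integrable (fun ω => ∑ t ∈ A, (b (W t ω) - e)) μ :=
  integrable_finsetSum _ fun t _ => (comp_integrable hW hQ hb t).sub (integrable_const _)

lemma FLLN.closure (hW : ∀ t, Measurable (W t)) (hQ : ∀ t, μ.map (W t) = Q) {b : P → ℝ}
    (hb : Integrable b Q)
    (happ : ∀ η : ℝ, 0 < η → ∃ b' : P → ℝ, Integrable b' Q ∧ ∫ x, |b x - b' x| ∂Q ≤ η ∧
      FLLN μ Q W b') : FLLN μ Q W b := by
  intro δ hδ
  obtain ⟨b', hb', hd, hL⟩ := happ (δ / 4) (by positivity)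
  obtain ⟨N, hN⟩ := hL (δ / 2) (by positivity)
  refine ⟨N, fun n hn A hA => ?_⟩
  have h1 := hN n hn A hA
  have hcard : (A.card : ℝ) ≤ n := by
    have := Finset.card_le_card hA
    simp at this; exact_mod_cast this
  set e := ∫ x, b x ∂Q
  set e' := ∫ x, b' x ∂Q
  have hee : |e - e'| ≤ δ / 4 := by
    have : e - e' = ∫ x, (b x - b' x) ∂Q := (integral_sub hb hb').symm
    rw [this]; exact abs_integral_le_integral_abs.trans hd
  have hdi : Integrable (fun x => |b x - b' x|) Q := (hb.sub hb').abs
  have hI2 : Integrable (fun ω => ∑ t ∈ A, |b (W t ω) - b' (W t ω)|) μ :=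
    integrable_finsetSum _ fun t _ => comp_integrable hW hQ hdi t
  calc ∫ ω, |∑ t ∈ A, (b (W t ω) - e)| ∂μ
      ≤ ∫ ω, (|∑ t ∈ A, (b' (W t ω) - e')| + ((∑ t ∈ A, |b (W t ω) - b' (W t ω)|)
          + A.card * |e - e'|)) ∂μ := by
        refine integral_mono_of_nonneg (ae_of_all _ fun _ => abs_nonneg _)
          ((sum_integrable hW hQ hb' e' A).abs.add (hI2.add (integrable_const _)))
          (ae_of_all _ fun ω => ?_)
        have : ∑ t ∈ A, (b (W t ω) - e) = ∑ t ∈ A, (b' (W t ω) - e')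
            + (∑ t ∈ A, (b (W t ω) - b' (W t ω)) - A.card * (e - e')) := by
          simp only [Finset.sum_sub_distrib, Finset.sum_const, nsmul_eq_mul]; ring
        simp only [this]
        refine (abs_add_le _ _).trans (add_le_add le_rfl ((abs_sub _ _).trans ?_))
        refine add_le_add (Finset.abs_sum_le_sum_abs _ _) ?_
        rw [abs_mul, Nat.abs_cast]
    _ = ∫ ω, |∑ t ∈ A, (b' (W t ω) - e')| ∂μ + (A.card * ∫ x, |b x - b' x| ∂Q
          + A.card * |e - e'|) := by
        have hI3 : Integrable (fun ω => (∑ t ∈ A, |b (W t ω) - b' (W t ω)|)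
          + A.card * |e - e'|) μ := hI2.add (integrable_const _)
        rw [integral_add (sum_integrable hW hQ hb' e' A).abs hI3,
          integral_add hI2 (integrable_const _),
          integral_finsetSum _ fun t _ => comp_integrable hW hQ hdi t]
        congr 2
        · rw [Finset.sum_congr rfl fun t _ => comp_integral hW hQ hdi t]; simp
        · simp
    _ ≤ δ / 2 * n + (n * (δ / 4) + n * (δ / 4)) := by
        have : 0 ≤ ∫ x, |b x - b' x| ∂Q := integral_nonneg fun _ => abs_nonneg _
        gcongr
    _ = δ * n := by ring

lemma FLLN.add (hW : ∀ t, Measurable (W t)) (hQ : ∀ t, μ.map (W t) = Q) {b b' : P → ℝ}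
    (hb : Integrable b Q) (hb' : Integrable b' Q) (h : FLLN μ Q W b) (h' : FLLN μ Q W b') :
    FLLN μ Q W (fun x => b x + b' x) := by
  intro δ hδ
  obtain ⟨N, hN⟩ := h (δ / 2) (by positivity)
  obtain ⟨N', hN'⟩ := h' (δ / 2) (by positivity)
  refine ⟨max N N', fun n hn A hA => ?_⟩
  have h1 := hN n ((le_max_left _ _).trans hn) A hA
  have h2 := hN' n ((le_max_right _ _).trans hn) A hA
  rw [integral_add hb hb']
  have : ∫ ω, |∑ t ∈ A, (b (W t ω) + b' (W t ω) - (∫ x, b x ∂Q + ∫ x, b' x ∂Q))| ∂μ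
      ≤ ∫ ω, (|∑ t ∈ A, (b (W t ω) - ∫ x, b x ∂Q)| + |∑ t ∈ A, (b' (W t ω) - ∫ x, b' x ∂Q)|) ∂μ := by
    refine integral_mono_of_nonneg (ae_of_all _ fun _ => abs_nonneg _)
      ((sum_integrable hW hQ hb _ A).abs.add (sum_integrable hW hQ hb' _ A).abs)
      (ae_of_all _ fun ω => ?_)
    simp only
    rw [show ∑ t ∈ A, (b (W t ω) + b' (W t ω) - (∫ x, b x ∂Q + ∫ x, b' x ∂Q))
      = ∑ t ∈ A, (b (W t ω) - ∫ x, b x ∂Q) + ∑ t ∈ A, (b' (W t ω) - ∫ x, b' x ∂Q) by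
        rw [← Finset.sum_add_distrib]; exact Finset.sum_congr rfl fun _ _ => by ring]
    exact abs_add_le _ _
  rw [integral_add (sum_integrable hW hQ hb _ A).abs (sum_integrable hW hQ hb' _ A).abs] at this
  linarith

lemma FLLN.smul {b : P → ℝ} (a : ℝ) (h : FLLN μ Q W b) :
    FLLN μ Q W (fun x => a * b x) := by
  intro δ hδ
  obtain ⟨N, hN⟩ := h (δ / (|a| + 1)) (by positivity)
  refine ⟨N, fun n hn A hA => ?_⟩
  have h1 := hN n hn A hA
  rw [integral_const_mul]
  simp_rw [← mul_sub, ← Finset.mul_sum, abs_mul]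
  rw [integral_const_mul]
  calc |a| * ∫ ω, |∑ t ∈ A, (b (W t ω) - ∫ x, b x ∂Q)| ∂μ
      ≤ |a| * (δ / (|a| + 1) * n) := by gcongr
    _ ≤ (|a| + 1) * (δ / (|a| + 1) * n) := by gcongr; linarith
    _ = δ * n := by field_simp

lemma FLLN.const (a : ℝ) : FLLN μ Q W (fun _ => a) := by
  intro δ hδ
  exact ⟨0, fun n _ A _ => by simp; positivity⟩

lemma FLLN.finset_sum (hW : ∀ t, Measurable (W t)) (hQ : ∀ t, μ.map (W t) = Q) {ι : Type*}
    (I : Finset ι) (b : ι → P → ℝ) (hb : ∀ i, Integrable (b i) Q) (h : ∀ i, FLLN μ Q W (b i)) :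
    FLLN μ Q W (fun x => ∑ i ∈ I, b i x) := by
  classical
  induction I using Finset.induction_on with
  | empty => simpa using FLLN.const 0
  | insert i I hi ih =>
    simp_rw [Finset.sum_insert hi]
    exact FLLN.add hW hQ (hb i) (integrable_finsetSum _ fun j _ => hb j) (h i) ih

lemma FLLN.of_piSystem (hW : ∀ t, Measurable (W t)) (hQ : ∀ t, μ.map (W t) = Q)
    (C : Set (Set P)) (hC : (inferInstance : MeasurableSpace P) = MeasurableSpace.generateFrom C)
    (hpi : IsPiSystem C) (hbase : ∀ s ∈ C, FLLN μ Q W (s.indicator fun _ => (1 : ℝ)))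
    (b : P → ℝ) (hb : Integrable b Q) : FLLN μ Q W b := by
  have hset : ∀ s, MeasurableSet s → FLLN μ Q W (s.indicator fun _ => (1 : ℝ)) := by
    intro s hs
    induction s, hs using MeasurableSpace.induction_on_inter hC hpi with
    | empty => simpa using FLLN.const 0
    | basic t ht => exact hbase t ht
    | compl t htm ih =>
      have : (tᶜ.indicator fun _ => (1 : ℝ))
          = fun x => 1 + (-1) * (t.indicator (fun _ => (1 : ℝ)) x) := by
        ext x; by_cases hx : x ∈ t <;> simp [hx]
      rw [this]
      exact FLLN.add hW hQ (integrable_const _)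
        (((integrable_const _).indicator htm).const_mul _) (FLLN.const 1) (ih.smul _)
    | iUnion f hd hfm ih =>
      refine FLLN.closure hW hQ ((integrable_const _).indicator (.iUnion hfm)) fun η hη => ?_
      have hs : HasSum (fun i => Q.real (f i)) (Q.real (⋃ i, f i)) := by
        have hne : ∀ i, Q (f i) ≠ ⊤ := fun i => measure_ne_top _ _
        have hu := measure_iUnion (μ := Q) hd hfm
        have hsum : ∑' i, Q (f i) ≠ ⊤ := by rw [← hu]; exact measure_ne_top _ _
        have := (ENNReal.hasSum_toReal hsum)
        rwa [← ENNReal.tsum_toReal_eq hne, ← hu] at this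
      have ht := hs.tendsto_sum_nat
      obtain ⟨N, hN⟩ := (Metric.tendsto_atTop.1 ht) η hη
      have hI : ∀ i, Integrable ((f i).indicator fun _ => (1 : ℝ)) Q := fun i =>
        (integrable_const _).indicator (hfm i)
      refine ⟨fun x => ∑ i ∈ Finset.range N, (f i).indicator (fun _ => (1 : ℝ)) x,
        integrable_finsetSum _ fun i _ => hI i, ?_, FLLN.finset_sum hW hQ _ _ hI ih⟩
      have hle : ∀ x, ∑ i ∈ Finset.range N, (f i).indicator (fun _ => (1 : ℝ)) x
          ≤ (⋃ i, f i).indicator (fun _ => (1 : ℝ)) x := by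
        intro x
        by_cases hx : ∃ i, x ∈ f i
        · obtain ⟨i, hi⟩ := hx
          rw [Set.indicator_of_mem (Set.mem_iUnion.2 ⟨i, hi⟩)]
          calc ∑ j ∈ Finset.range N, (f j).indicator (fun _ => (1 : ℝ)) x
              ≤ ∑ j ∈ Finset.range N, if j = i then (1 : ℝ) else 0 := by
                refine Finset.sum_le_sum fun j _ => ?_
                split_ifs with hj
                · exact Set.indicator_le_self' (fun _ _ => zero_le_one) x
                · rw [Set.indicator_of_notMem]
                  exact fun hxj => Set.disjoint_left.1 (hd hj) hxj hi
            _ ≤ 1 := by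
                rw [Finset.sum_ite_eq']; split_ifs <;> norm_num
        · push Not at hx
          simp [hx]
      have habs : ∀ x, |(⋃ i, f i).indicator (fun _ => (1 : ℝ)) x
          - ∑ i ∈ Finset.range N, (f i).indicator (fun _ => (1 : ℝ)) x|
          = (⋃ i, f i).indicator (fun _ => (1 : ℝ)) x
          - ∑ i ∈ Finset.range N, (f i).indicator (fun _ => (1 : ℝ)) x := fun x =>
        abs_of_nonneg (by linarith [hle x])
      simp_rw [habs]
      rw [integral_sub ((integrable_const _).indicator (.iUnion hfm))
        (integrable_finsetSum _ fun i _ => hI i), integral_finsetSum _ fun i _ => hI i,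
        integral_indicator (.iUnion hfm)]
      have : ∀ i, ∫ x, (f i).indicator (fun _ => (1 : ℝ)) x ∂Q = Q.real (f i) := fun i => by
        rw [integral_indicator (hfm i)]; simp
      simp_rw [this]
      have h3 := hN N le_rfl
      rw [Real.dist_eq, abs_lt] at h3
      simp
      linarith [h3.1]
  have hsimple : ∀ g : SimpleFunc P ℝ, FLLN μ Q W g := by
    intro g
    induction g using SimpleFunc.induction with
    | const c hs =>
      rename_i s
      have : (⇑(SimpleFunc.piecewise s hs (SimpleFunc.const P c) (SimpleFunc.const P 0)))
          = fun x => c * s.indicator (fun _ => (1 : ℝ)) x := by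
        ext x; by_cases hx : x ∈ s <;> simp [hx]
      rw [this]
      exact (hset s hs).smul c
    | add hd hf hg =>
      exact FLLN.add hW hQ (SimpleFunc.integrable_of_isFiniteMeasure _)
        (SimpleFunc.integrable_of_isFiniteMeasure _) hf hg
  refine FLLN.closure hW hQ hb fun η hη => ?_
  obtain ⟨g, hg, hgi⟩ := (memLp_one_iff_integrable.2 hb).exists_simpleFunc_eLpNorm_sub_lt
    (by simp) (ε := ENNReal.ofReal η) (by simp [hη])
  refine ⟨g, memLp_one_iff_integrable.1 hgi, ?_, hsimple g⟩
  have hbg : Integrable (b - (g : P → ℝ)) Q := hb.sub (memLp_one_iff_integrable.1 hgi)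
  have : ∫ x, |b x - g x| ∂Q = (eLpNorm (b - (g : P → ℝ)) 1 Q).toReal := by
    rw [eLpNorm_one_eq_lintegral_enorm, ← integral_norm_eq_lintegral_enorm hbg.1]; rfl
  rw [this]
  exact (ENNReal.toReal_le_of_le_ofReal hη.le hg.le)

end ulln
section mixing

variable {Ω : Type*} [MeasurableSpace Ω]

lemma sigmaIcc_le {Ω : Type*} [m0 : MeasurableSpace Ω] {Z : ℤ → Ω → ℝ} (hZ : ∀ t, Measurable (Z t)) (k l : ℤ) :
    sigmaIcc Z k l ≤ m0 :=
  iSup₂_le fun i _ => (hZ i).comap_le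

lemma sigmaIci_le {Ω : Type*} [m0 : MeasurableSpace Ω] {Z : ℤ → Ω → ℝ} (hZ : ∀ t, Measurable (Z t)) (k : ℤ) :
    sigmaIci Z k ≤ m0 :=
  iSup₂_le fun i _ => (hZ i).comap_le

lemma sum_real_partition (μ : Measure Ω) [IsProbabilityMeasure μ] {J : ℕ} (B : Fin J → Set Ω)
    (hB : ∀ j, MeasurableSet (B j)) (hd : Pairwise (Function.onFun Disjoint B))
    (hu : (⋃ j, B j) = Set.univ) (A : Set Ω) (hA : MeasurableSet A) :
    ∑ j, μ.real (A ∩ B j) = μ.real A := by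
  rw [← measureReal_iUnion_fintype, ← Set.inter_iUnion, hu, Set.inter_univ]
  · intro i j hij
    exact (hd hij).mono Set.inter_subset_right Set.inter_subset_right
  · exact fun j => hA.inter (hB j)

lemma betaCoeff_set_le {Ω : Type*} (m₁ m₂ : MeasurableSpace Ω) [m0 : MeasurableSpace Ω]
    (μ : Measure Ω) [IsProbabilityMeasure μ] (h1 : m₁ ≤ m0) (h2 : m₂ ≤ m0) :
    ∀ r ∈ {r : ℝ | ∃ (I J : ℕ) (A : Fin I → Set Ω) (B : Fin J → Set Ω),
    (∀ i, MeasurableSet[m₁] (A i)) ∧ (∀ j, MeasurableSet[m₂] (B j)) ∧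
    Pairwise (Function.onFun Disjoint A) ∧ Pairwise (Function.onFun Disjoint B) ∧
    (⋃ i, A i) = Set.univ ∧ (⋃ j, B j) = Set.univ ∧
    r = ∑ i, ∑ j, |(μ (A i ∩ B j)).toReal - (μ (A i)).toReal * (μ (B j)).toReal|}, r ≤ 2 := by
  rintro r ⟨I, J, A, B, hA, hB, hdA, hdB, huA, huB, rfl⟩
  have hA' : ∀ i, MeasurableSet (A i) := fun i => h1 _ (hA i)
  have hB' : ∀ j, MeasurableSet (B j) := fun j => h2 _ (hB j)
  have sA : ∑ i, μ.real (A i) = 1 := by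
    simpa using sum_real_partition μ A hA' hdA huA Set.univ MeasurableSet.univ
  have sB : ∑ j, μ.real (B j) = 1 := by
    simpa using sum_real_partition μ B hB' hdB huB Set.univ MeasurableSet.univ
  calc ∑ i, ∑ j, |(μ (A i ∩ B j)).toReal - (μ (A i)).toReal * (μ (B j)).toReal|
      ≤ ∑ i, ∑ j, (μ.real (A i ∩ B j) + μ.real (A i) * μ.real (B j)) := by
        refine Finset.sum_le_sum fun i _ => Finset.sum_le_sum fun j _ => ?_
        refine (abs_sub _ _).trans (le_of_eq ?_)
        rw [abs_of_nonneg ENNReal.toReal_nonneg,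
          abs_of_nonneg (mul_nonneg ENNReal.toReal_nonneg ENNReal.toReal_nonneg)]
        rfl
    _ = ∑ i, (μ.real (A i) + μ.real (A i) * 1) := by
        refine Finset.sum_congr rfl fun i _ => ?_
        rw [Finset.sum_add_distrib, sum_real_partition μ B hB' hdB huB _ (hA' i),
          ← Finset.mul_sum, sB]
    _ = 2 := by rw [Finset.sum_add_distrib, ← Finset.sum_mul, sA]; norm_num

lemma cov_le_betaCoeff {Ω : Type*} (m₁ m₂ : MeasurableSpace Ω) [m0 : MeasurableSpace Ω]
    (μ : Measure Ω) [IsProbabilityMeasure μ] (h1 : m₁ ≤ m0) (h2 : m₂ ≤ m0)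
    (A B : Set Ω) (hA : MeasurableSet[m₁] A) (hB : MeasurableSet[m₂] B) :
    |μ.real (A ∩ B) - μ.real A * μ.real B| ≤ betaCoeff μ m₁ m₂ := by
  have hle : ∑ i : Fin 2, ∑ j : Fin 2, |(μ ((![A, Aᶜ] : Fin 2 → Set Ω) i ∩
      (![B, Bᶜ] : Fin 2 → Set Ω) j)).toReal - (μ ((![A, Aᶜ] : Fin 2 → Set Ω) i)).toReal
        * (μ ((![B, Bᶜ] : Fin 2 → Set Ω) j)).toReal| ≤ betaCoeff μ m₁ m₂ := by
    refine le_csSup ⟨2, betaCoeff_set_le m₁ m₂ μ h1 h2⟩ ⟨2, 2, ![A, Aᶜ], ![B, Bᶜ], ?_, ?_, ?_, ?_,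
      ?_, ?_, rfl⟩
    · intro i; fin_cases i
      · exact hA
      · exact hA.compl
    · intro i; fin_cases i
      · exact hB
      · exact hB.compl
    · intro i j hij
      fin_cases i <;> fin_cases j <;> simp_all [Function.onFun, disjoint_compl_right, disjoint_compl_left]
    · intro i j hij
      fin_cases i <;> fin_cases j <;> simp_all [Function.onFun, disjoint_compl_right, disjoint_compl_left]
    · ext x; simp [Fin.exists_fin_two, em]
    · ext x; simp [Fin.exists_fin_two, em]
  refine le_trans ?_ hle
  have h3 := Finset.single_le_sum (f := fun i : Fin 2 => ∑ j : Fin 2,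
      |(μ ((![A, Aᶜ] : Fin 2 → Set Ω) i ∩
      (![B, Bᶜ] : Fin 2 → Set Ω) j)).toReal - (μ ((![A, Aᶜ] : Fin 2 → Set Ω) i)).toReal
        * (μ ((![B, Bᶜ] : Fin 2 → Set Ω) j)).toReal|)
      (fun i _ => Finset.sum_nonneg fun j _ => abs_nonneg _) (Finset.mem_univ 0)
  refine le_trans ?_ h3
  exact Finset.single_le_sum (f := fun j : Fin 2 =>
      |(μ ((![A, Aᶜ] : Fin 2 → Set Ω) 0 ∩
      (![B, Bᶜ] : Fin 2 → Set Ω) j)).toReal - (μ ((![A, Aᶜ] : Fin 2 → Set Ω) 0)).toReal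
        * (μ ((![B, Bᶜ] : Fin 2 → Set Ω) j)).toReal|)
      (fun i _ => abs_nonneg _) (Finset.mem_univ 0)

lemma betaCoeff_le_betaMix (μ : Measure Ω) [IsProbabilityMeasure μ] (Z : ℤ → Ω → ℝ)
    (hZ : ∀ t, Measurable (Z t)) (n : ℕ) (hn : 1 ≤ n) (k : ℕ) :
    betaCoeff μ (sigmaIcc Z 1 n) (sigmaIci Z (n + k)) ≤ betaMix μ Z k := by
  refine le_csSup ⟨2, ?_⟩ ⟨n, hn, rfl⟩
  rintro r ⟨n', _, rfl⟩
  exact Real.sSup_le (betaCoeff_set_le _ _ μ (sigmaIcc_le hZ _ _) (sigmaIci_le hZ _)) (by norm_num)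

/-- Law of large numbers for functionals of the mixing process. -/
lemma flln_of_mixing (μ : Measure Ω) [IsProbabilityMeasure μ]
    (Z : ℤ → Ω → ℝ) (hZ : ∀ t, Measurable (Z t)) (hstat : Stationary μ Z)
    (hreg : Tendsto (betaMix μ Z) atTop (nhds 0)) (b : (ℤ → ℝ) → ℝ)
    (hb : Integrable b (μ.map (fun ω k => Z k ω))) :
    FLLN μ (μ.map (fun ω k => Z k ω)) (fun (t : ℕ) ω => fun k : ℤ => Z (t + k) ω) b := by
  have hpath : ∀ j : ℤ, Measurable (fun ω => fun k : ℤ => Z (j + k) ω) := fun j =>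
    measurable_pi_lambda _ fun k => hZ _
  have hpath0 : Measurable (fun ω => fun k : ℤ => Z k ω) := measurable_pi_lambda _ fun k => hZ _
  have hst : ∀ j : ℤ, μ.map (fun ω => fun k : ℤ => Z (j + k) ω) = μ.map (fun ω k => Z k ω) := by
    intro j
    rw [← hstat j]
    simp_rw [add_comm j]
  have hprob : IsProbabilityMeasure (μ.map (fun ω k => Z k ω)) :=
    Measure.isProbabilityMeasure_map hpath0.aemeasurable
  refine FLLN.of_piSystem (fun t => hpath t) (fun t => hst t)
    (measurableCylinders (fun _ : ℤ => ℝ)) generateFrom_measurableCylinders.symm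
    isPiSystem_measurableCylinders ?_ b hb
  intro C hC
  have hCm : MeasurableSet C := MeasurableSet.of_mem_measurableCylinders hC
  obtain ⟨S, T, hT, rfl⟩ := (mem_measurableCylinders _).1 hC
  obtain ⟨K, hK⟩ : ∃ K : ℕ, ∀ i ∈ S, -(K : ℤ) ≤ i ∧ i ≤ K := by
    refine ⟨S.sup Int.natAbs, fun i hi => ?_⟩
    have := Finset.le_sup (f := Int.natAbs) hi
    omega
  -- measurability of shifted events
  have hms : ∀ (j : ℤ) (m : MeasurableSpace Ω), (∀ i ∈ S, Measurable[m] (Z (j + i))) →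
      MeasurableSet[m] ((fun ω => fun k : ℤ => Z (j + k) ω) ⁻¹' (cylinder S T)) := by
    intro j m hm
    have : Measurable[m] (fun ω => fun i : S => Z (j + i) ω) :=
      @measurable_pi_lambda _ _ _ m _ _ fun i => hm i i.2
    exact this hT
  have hQ1 : (∫ x, (cylinder S T).indicator (fun _ => (1 : ℝ)) x ∂(μ.map (fun ω k => Z k ω)))
      = (μ.map (fun ω k => Z k ω)).real (cylinder S T) := by
    rw [integral_indicator hCm]; simp
  unfold FLLN
  rw [hQ1]
  have hreal : ∀ j : ℤ, μ.real ((fun ω => fun k : ℤ => Z (j + k) ω) ⁻¹' (cylinder S T))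
      = (μ.map (fun ω k => Z k ω)).real (cylinder S T) := by
    intro j
    rw [← hst j, measureReal_def, measureReal_def, Measure.map_apply (hpath j) hCm]
  set p := (μ.map (fun ω k => Z k ω)).real (cylinder S T)
  refine ulln_of_cov μ (fun t : ℕ => (fun ω => fun k : ℤ => Z (t + k) ω) ⁻¹' (cylinder S T))
    (fun t => (hpath t) hCm) p (fun t => hreal t) ?_
  intro δ hδ
  obtain ⟨M, hM⟩ := (Metric.tendsto_atTop.1 hreg) δ hδ
  refine ⟨M + 2 * K, fun s t hst' => ?_⟩
  -- shift
  have hshift : μ.real ((fun ω => fun k : ℤ => Z (s + k) ω) ⁻¹' (cylinder S T) ∩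
      (fun ω => fun k : ℤ => Z (t + k) ω) ⁻¹' (cylinder S T))
      = μ.real ((fun ω => fun k : ℤ => Z (((K : ℤ) + 1) + k) ω) ⁻¹' (cylinder S T) ∩
      (fun ω => fun k : ℤ => Z (((K : ℤ) + 1 + (t - s)) + k) ω) ⁻¹' (cylinder S T)) := by
    let D : Set (ℤ → ℝ) := cylinder S T ∩
      (fun z : ℤ → ℝ => fun k : ℤ => z ((t - s : ℤ) + k)) ⁻¹' (cylinder S T)
    have hD : MeasurableSet D := hCm.inter
      ((measurable_pi_lambda _ fun k => measurable_pi_apply _) hCm)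
    have key : ∀ j : ℤ, μ.real ((fun ω => fun k : ℤ => Z (j + k) ω) ⁻¹' (cylinder S T) ∩
      (fun ω => fun k : ℤ => Z ((j + (t - s)) + k) ω) ⁻¹' (cylinder S T))
        = (μ.map (fun ω k => Z k ω)).real D := by
      intro j
      rw [← hst j, measureReal_def, measureReal_def, Measure.map_apply (hpath j) hD]
      congr 2
      ext ω
      simp only [D, Set.mem_inter_iff, Set.mem_preimage, add_assoc]
    have k1 := key s
    rw [show (s : ℤ) + (t - s) = t by ring] at k1
    rw [k1, key]
  rw [hshift]
  obtain ⟨q, hq⟩ : ∃ q : ℕ, (t : ℤ) - s = 2 * K + q ∧ M ≤ q :=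
    ⟨t - s - 2 * K, by omega, by omega⟩
  have hcomap : ∀ (k l i : ℤ), i ∈ Set.Icc k l → Measurable[sigmaIcc Z k l] (Z i) := by
    intro k l i hi
    exact measurable_iff_comap_le.2 (le_iSup₂_of_le i hi le_rfl)
  have hcomap' : ∀ (k i : ℤ), i ∈ Set.Ici k → Measurable[sigmaIci Z k] (Z i) := by
    intro k i hi
    exact measurable_iff_comap_le.2 (le_iSup₂_of_le i hi le_rfl)
  have hcov := cov_le_betaCoeff (sigmaIcc Z 1 ((2 * K + 1 : ℕ) : ℤ))
    (sigmaIci Z (((2 * K + 1 : ℕ) : ℤ) + q)) μ (sigmaIcc_le hZ _ _) (sigmaIci_le hZ _)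
    _ _ (hms ((K : ℤ) + 1) _ fun i hi => hcomap _ _ _ (by
      have := hK i hi; constructor <;> push_cast <;> omega))
    (hms ((K : ℤ) + 1 + (t - s)) _ fun i hi => hcomap' _ _ (by
      have := hK i hi; simp only [Set.mem_Ici]; push_cast; omega))
  rw [hreal, hreal] at hcov
  refine hcov.trans ((betaCoeff_le_betaMix μ Z hZ _ (by omega) q).trans ?_)
  have := hM q hq.2
  rw [Real.dist_eq, sub_zero] at this
  exact (le_abs_self _).trans this.le

end mixing
section plln

/-- ordered pairs in `{1..n}` -/
def pairs (n : ℕ) : Finset (ℕ × ℕ) :=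
  (Finset.Icc 1 n ×ˢ Finset.Icc 1 n).filter fun p => p.1 < p.2

lemma mem_pairs {n : ℕ} {p : ℕ × ℕ} (hp : p ∈ pairs n) : 1 ≤ p.1 ∧ p.1 < p.2 ∧ p.2 ≤ n := by
  simp only [pairs, Finset.mem_filter, Finset.mem_product, Finset.mem_Icc] at hp
  omega

lemma card_pairs_le (n : ℕ) : ((pairs n).card : ℝ) ≤ (n : ℝ) ^ 2 := by
  have : (pairs n).card ≤ n * n := by
    refine (Finset.card_filter_le _ _).trans ?_
    simp
  calc ((pairs n).card : ℝ) ≤ ((n * n : ℕ) : ℝ) := by exact_mod_cast this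
    _ = (n : ℝ) ^ 2 := by push_cast; ring

lemma sum_pairs_left (n : ℕ) (g : ℕ × ℕ → ℝ) :
    ∑ p ∈ pairs n, g p = ∑ s ∈ Finset.Icc 1 n, ∑ t ∈ (Finset.Icc 1 n).filter (fun t => s < t),
      g (s, t) := by
  simp only [pairs, Finset.sum_filter, Finset.sum_product]

lemma sum_pairs_right (n : ℕ) (g : ℕ × ℕ → ℝ) :
    ∑ p ∈ pairs n, g p = ∑ t ∈ Finset.Icc 1 n, ∑ s ∈ (Finset.Icc 1 n).filter (fun s => s < t),
      g (s, t) := by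
  simp only [pairs, Finset.sum_filter, Finset.sum_product_right]

lemma sum_offdiag (n : ℕ) (g : ℕ → ℕ → ℝ) (hg : ∀ s t, g s t = g t s) :
    ∑ s ∈ Finset.Icc 1 n, ∑ t ∈ Finset.Icc 1 n, (if s ≠ t then g s t else 0)
      = 2 * ∑ p ∈ pairs n, g p.1 p.2 := by
  have e1 := sum_pairs_left n (fun p => g p.1 p.2)
  have e2 := sum_pairs_right n (fun p => g p.1 p.2)
  simp only [Finset.sum_filter] at e1 e2
  rw [two_mul]
  nth_rewrite 1 [e1]
  rw [e2, ← Finset.sum_add_distrib]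
  refine Finset.sum_congr rfl fun s _ => ?_
  rw [← Finset.sum_add_distrib]
  refine Finset.sum_congr rfl fun t _ => ?_
  rcases lt_trichotomy s t with h | h | h
  · simp [h, h.ne, h.not_gt]
  · simp [h]
  · simp [h, h.ne', h.not_gt, hg s t]

lemma card_pairs (n : ℕ) : 2 * ((pairs n).card : ℝ) = (n : ℝ) * ((n : ℝ) - 1) := by
  have := sum_offdiag n (fun _ _ => 1) (fun _ _ => rfl)
  simp only [Finset.sum_const, nsmul_eq_mul, mul_one] at this
  rw [← this]
  have h1 : ∀ s ∈ Finset.Icc 1 n, ∑ t ∈ Finset.Icc 1 n, (if s ≠ t then (1 : ℝ) else 0)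
      = (n : ℝ) - 1 := by
    intro s hs
    have : ∀ t, (if s ≠ t then (1 : ℝ) else 0) = 1 - (if s = t then 1 else 0) := by
      intro t; by_cases h : s = t <;> simp [h]
    simp_rw [this, Finset.sum_sub_distrib, Finset.sum_ite_eq, if_pos hs]
    simp
  rw [Finset.sum_congr rfl h1]
  simp
  ring

variable {Ω E : Type*} [MeasurableSpace Ω] [MeasurableSpace E]

/-- Law of large numbers in `L¹` for sums over ordered pairs. -/
def PLLN (μ : Measure Ω) (X : ℕ → Ω → E) (G : E → E → ℝ) (θ : ℝ) : Prop :=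
  ∀ δ : ℝ, 0 < δ → ∃ N : ℕ, ∀ n, N ≤ n →
    ∫ ω, |∑ p ∈ pairs n, (G (X p.1 ω) (X p.2 ω) - θ)| ∂μ ≤ δ * (n : ℝ) ^ 2

variable {μ : Measure Ω} [IsProbabilityMeasure μ] {X : ℕ → Ω → E}

lemma pairs_integrable {G : E → E → ℝ}
    (hG : ∀ s t, 1 ≤ s → s < t → Integrable (fun ω => G (X s ω) (X t ω)) μ) (θ : ℝ) (n : ℕ) :
    Integrable (fun ω => ∑ p ∈ pairs n, (G (X p.1 ω) (X p.2 ω) - θ)) μ := by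
  refine integrable_finsetSum _ fun p hp => ?_
  have := mem_pairs hp
  exact (hG _ _ this.1 this.2.1).sub (integrable_const _)

lemma PLLN.closure {G : E → E → ℝ} {θ : ℝ}
    (hG : ∀ s t, 1 ≤ s → s < t → Integrable (fun ω => G (X s ω) (X t ω)) μ)
    (happ : ∀ η : ℝ, 0 < η → ∃ (G' : E → E → ℝ) (θ' : ℝ),
      (∀ s t, 1 ≤ s → s < t → Integrable (fun ω => G' (X s ω) (X t ω)) μ) ∧
      (∀ s t, 1 ≤ s → s < t → ∫ ω, |G (X s ω) (X t ω) - G' (X s ω) (X t ω)| ∂μ ≤ η) ∧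
      |θ - θ'| ≤ η ∧ PLLN μ X G' θ') : PLLN μ X G θ := by
  intro δ hδ
  obtain ⟨G', θ', hG', hd, hθ, hP⟩ := happ (δ / 3) (by positivity)
  obtain ⟨N, hN⟩ := hP (δ / 3) (by positivity)
  refine ⟨N, fun n hn => ?_⟩
  have iD : ∀ p ∈ pairs n, Integrable
      (fun ω => |G (X p.1 ω) (X p.2 ω) - G' (X p.1 ω) (X p.2 ω)|) μ := fun p hp => by
    have := mem_pairs hp
    exact ((hG _ _ this.1 this.2.1).sub (hG' _ _ this.1 this.2.1)).abs
  have i1 := (pairs_integrable hG θ n).abs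
  have i2 : Integrable (fun ω => |∑ p ∈ pairs n, (G' (X p.1 ω) (X p.2 ω) - θ')|) μ :=
    (pairs_integrable hG' θ' n).abs
  have i3 : Integrable (fun ω => ∑ p ∈ pairs n,
      |G (X p.1 ω) (X p.2 ω) - G' (X p.1 ω) (X p.2 ω)|) μ := integrable_finsetSum _ iD
  have i4 : Integrable (fun _ : Ω => ((pairs n).card : ℝ) * |θ - θ'|) μ := integrable_const _
  have hpt : ∀ ω, |∑ p ∈ pairs n, (G (X p.1 ω) (X p.2 ω) - θ)|
      ≤ |∑ p ∈ pairs n, (G' (X p.1 ω) (X p.2 ω) - θ')| + (∑ p ∈ pairs n,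
      |G (X p.1 ω) (X p.2 ω) - G' (X p.1 ω) (X p.2 ω)| + (pairs n).card * |θ - θ'|) := by
    intro ω
    have e : ∑ p ∈ pairs n, (G (X p.1 ω) (X p.2 ω) - θ)
        = ∑ p ∈ pairs n, (G' (X p.1 ω) (X p.2 ω) - θ') +
          (∑ p ∈ pairs n, (G (X p.1 ω) (X p.2 ω) - G' (X p.1 ω) (X p.2 ω))
            + (pairs n).card * (θ' - θ)) := by
      simp only [Finset.sum_sub_distrib, Finset.sum_const, nsmul_eq_mul]
      ring
    rw [e]
    refine (abs_add_le _ _).trans (add_le_add le_rfl ((abs_add_le _ _).trans (add_le_add ?_ ?_)))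
    · exact Finset.abs_sum_le_sum_abs _ _
    · rw [abs_mul, Nat.abs_cast, abs_sub_comm]
  have i34 : Integrable (fun ω => (∑ p ∈ pairs n,
      |G (X p.1 ω) (X p.2 ω) - G' (X p.1 ω) (X p.2 ω)| + (pairs n).card * |θ - θ'|)) μ := i3.add i4
  have hle := integral_mono i1 (i2.add i34) hpt
  simp only [Pi.add_apply] at hle
  rw [integral_add i2 i34, integral_add i3 i4, integral_finsetSum _ iD] at hle
  have b3 : ∑ p ∈ pairs n, ∫ ω, |G (X p.1 ω) (X p.2 ω) - G' (X p.1 ω) (X p.2 ω)| ∂μ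
      ≤ (pairs n).card * (δ / 3) := by
    rw [← nsmul_eq_mul]
    refine Finset.sum_le_card_nsmul _ _ _ fun p hp => ?_
    have := mem_pairs hp
    exact hd _ _ this.1 this.2.1
  have b4 : ∫ _ : Ω, ((pairs n).card : ℝ) * |θ - θ'| ∂μ ≤ (pairs n).card * (δ / 3) := by
    rw [integral_const]
    simp only [probReal_univ, one_smul]
    gcongr
  have b2 := hN n hn
  have bc : ((pairs n).card : ℝ) * (δ / 3) ≤ (n : ℝ) ^ 2 * (δ / 3) := by
    gcongr; exact card_pairs_le n
  have : ∫ ω, |∑ p ∈ pairs n, (G (X p.1 ω) (X p.2 ω) - θ)| ∂μ ≤ _ := hle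
  linarith

lemma PLLN.finset_sum {ι : Type*} (S : Finset ι) {G : ι → E → E → ℝ} {θ : ι → ℝ}
    (hG : ∀ i ∈ S, ∀ s t, 1 ≤ s → s < t → Integrable (fun ω => G i (X s ω) (X t ω)) μ)
    (hP : ∀ i ∈ S, PLLN μ X (G i) (θ i)) :
    PLLN μ X (fun x y => ∑ i ∈ S, G i x y) (∑ i ∈ S, θ i) := by
  intro δ hδ
  have hc : (0 : ℝ) < S.card + 1 := by positivity
  have := fun i (hi : i ∈ S) => hP i hi (δ / (S.card + 1)) (by positivity)
  choose! N hN using this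
  refine ⟨S.sup N, fun n hn => ?_⟩
  have iI : ∀ i ∈ S, Integrable (fun ω => |∑ p ∈ pairs n, (G i (X p.1 ω) (X p.2 ω) - θ i)|) μ :=
    fun i hi => (pairs_integrable (hG i hi) (θ i) n).abs
  calc ∫ ω, |∑ p ∈ pairs n, (∑ i ∈ S, G i (X p.1 ω) (X p.2 ω) - ∑ i ∈ S, θ i)| ∂μ
      ≤ ∫ ω, ∑ i ∈ S, |∑ p ∈ pairs n, (G i (X p.1 ω) (X p.2 ω) - θ i)| ∂μ := by
        refine integral_mono_of_nonneg (ae_of_all _ fun _ => abs_nonneg _)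
          (integrable_finsetSum _ iI) (ae_of_all _ fun ω => ?_)
        simp only [← Finset.sum_sub_distrib]
        rw [Finset.sum_comm]
        exact Finset.abs_sum_le_sum_abs _ _
    _ = ∑ i ∈ S, ∫ ω, |∑ p ∈ pairs n, (G i (X p.1 ω) (X p.2 ω) - θ i)| ∂μ :=
        integral_finsetSum _ iI
    _ ≤ S.card • (δ / (S.card + 1) * (n : ℝ) ^ 2) :=
        Finset.sum_le_card_nsmul _ _ _ fun i hi =>
          hN i hi n ((Finset.le_sup (f := N) hi).trans hn)
    _ ≤ δ * (n : ℝ) ^ 2 := by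
        rw [nsmul_eq_mul, ← mul_assoc]
        gcongr
        rw [← mul_div_assoc, div_le_iff₀ hc]
        nlinarith

/-- product kernels -/
lemma PLLN.mul (hX : ∀ t, Measurable (X t)) {α β : E → ℝ} (hα : Measurable α) (hβ : Measurable β)
    {K : ℝ} (hαK : ∀ x, |α x| ≤ K) (hβK : ∀ x, |β x| ≤ K) {eα eβ : ℝ} (heα : |eα| ≤ K)
    (Lα : ULLN μ (fun t ω => α (X t ω)) eα) (Lβ : ULLN μ (fun t ω => β (X t ω)) eβ) :
    PLLN μ X (fun x y => α x * β y) (eα * eβ) := by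
  intro δ hδ
  have hK0 : 0 ≤ K := (abs_nonneg _).trans heα
  have hK1 : 0 < 2 * (K + 1) := by positivity
  obtain ⟨N1, hN1⟩ := Lα (δ / (2 * (K + 1))) (by positivity)
  obtain ⟨N2, hN2⟩ := Lβ (δ / (2 * (K + 1))) (by positivity)
  refine ⟨max N1 N2, fun n hn => ?_⟩
  have iα : ∀ t, Integrable (fun ω => α (X t ω)) μ := fun t =>
    Integrable.of_bound (hα.comp (hX t)).aestronglyMeasurable K (ae_of_all _ fun ω => hαK _)
  have iβ : ∀ t, Integrable (fun ω => β (X t ω)) μ := fun t =>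
    Integrable.of_bound (hβ.comp (hX t)).aestronglyMeasurable K (ae_of_all _ fun ω => hβK _)
  have iA : ∀ A : Finset ℕ, Integrable (fun ω => |∑ s ∈ A, (α (X s ω) - eα)|) μ := fun A =>
    (integrable_finsetSum _ fun s _ => (iα s).sub (integrable_const _)).abs
  have iB : ∀ A : Finset ℕ, Integrable (fun ω => |∑ s ∈ A, (β (X s ω) - eβ)|) μ := fun A =>
    (integrable_finsetSum _ fun s _ => (iβ s).sub (integrable_const _)).abs
  have hpt : ∀ ω, |∑ p ∈ pairs n, (α (X p.1 ω) * β (X p.2 ω) - eα * eβ)|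
      ≤ ∑ t ∈ Finset.Icc 1 n, K * |∑ s ∈ (Finset.Icc 1 n).filter (fun s => s < t),
          (α (X s ω) - eα)|
        + ∑ s ∈ Finset.Icc 1 n, K * |∑ t ∈ (Finset.Icc 1 n).filter (fun t => s < t),
          (β (X t ω) - eβ)| := by
    intro ω
    have e : ∑ p ∈ pairs n, (α (X p.1 ω) * β (X p.2 ω) - eα * eβ)
        = ∑ p ∈ pairs n, β (X p.2 ω) * (α (X p.1 ω) - eα)
          + ∑ p ∈ pairs n, eα * (β (X p.2 ω) - eβ) := by
      rw [← Finset.sum_add_distrib]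
      exact Finset.sum_congr rfl fun p _ => by ring
    rw [e, sum_pairs_right, sum_pairs_left]
    simp only [← Finset.mul_sum]
    refine (abs_add_le _ _).trans (add_le_add ?_ ?_)
    · rw [Finset.mul_sum]
      refine (Finset.abs_sum_le_sum_abs _ _).trans (Finset.sum_le_sum fun t _ => ?_)
      rw [abs_mul]
      gcongr
      exact hβK _
    · rw [abs_mul]
      exact mul_le_mul heα (Finset.abs_sum_le_sum_abs _ _) (abs_nonneg _) hK0
  have j1 : ∀ t ∈ Finset.Icc 1 n, Integrable (fun ω => K *
      |∑ s ∈ (Finset.Icc 1 n).filter (fun s => s < t), (α (X s ω) - eα)|) μ :=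
    fun t _ => (iA _).const_mul K
  have j2 : ∀ s ∈ Finset.Icc 1 n, Integrable (fun ω => K *
      |∑ t ∈ (Finset.Icc 1 n).filter (fun t => s < t), (β (X t ω) - eβ)|) μ :=
    fun t _ => (iB _).const_mul K
  have k1 := integrable_finsetSum _ j1
  have k2 := integrable_finsetSum _ j2
  have hle := integral_mono_of_nonneg (ae_of_all μ fun _ => abs_nonneg _) (k1.add k2)
    (ae_of_all μ hpt)
  simp only [Pi.add_apply] at hle
  rw [integral_add k1 k2, integral_finsetSum _ j1, integral_finsetSum _ j2] at hle
  have b1 : ∑ t ∈ Finset.Icc 1 n, ∫ ω, K *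
      |∑ s ∈ (Finset.Icc 1 n).filter (fun s => s < t), (α (X s ω) - eα)| ∂μ
      ≤ (Finset.Icc 1 n).card • (K * (δ / (2 * (K + 1)) * n)) := by
    refine Finset.sum_le_card_nsmul _ _ _ fun t _ => ?_
    rw [integral_const_mul]
    gcongr
    exact hN1 n (le_of_max_le_left hn) _ (Finset.filter_subset _ _)
  have b2 : ∑ s ∈ Finset.Icc 1 n, ∫ ω, K *
      |∑ t ∈ (Finset.Icc 1 n).filter (fun t => s < t), (β (X t ω) - eβ)| ∂μ
      ≤ (Finset.Icc 1 n).card • (K * (δ / (2 * (K + 1)) * n)) := by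
    refine Finset.sum_le_card_nsmul _ _ _ fun t _ => ?_
    rw [integral_const_mul]
    gcongr
    exact hN2 n (le_of_max_le_right hn) _ (Finset.filter_subset _ _)
  simp only [Nat.card_Icc, Nat.add_sub_cancel, nsmul_eq_mul] at b1 b2
  have b3 : (n : ℝ) * (K * (δ / (2 * (K + 1)) * n)) ≤ δ / 2 * (n : ℝ) ^ 2 := by
    have : K * (δ / (2 * (K + 1))) ≤ δ / 2 := by
      rw [← mul_div_assoc, div_le_div_iff₀ hK1 (by norm_num)]
      nlinarith
    calc (n : ℝ) * (K * (δ / (2 * (K + 1)) * n)) = K * (δ / (2 * (K + 1))) * (n : ℝ) ^ 2 := by ring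
      _ ≤ _ := by gcongr
  linarith

end plln
section bounded

variable {E : Type} [NormedAddCommGroup E] [MeasurableSpace E] [BorelSpace E]
  [SecondCountableTopology E]

lemma exists_simple_approx (F : Measure E) [IsProbabilityMeasure F] (ε η : ℝ) (hε : 0 < ε)
    (hη : 0 < η) : ∃ c : SimpleFunc E E, F.real {x | ε < ‖c x - x‖} ≤ η := by
  have ht : TendstoInMeasure F
      (fun N x => SimpleFunc.nearestPt (TopologicalSpace.denseSeq E) N x) atTop (fun x => x) := by
    refine tendstoInMeasure_of_tendsto_ae (fun N => ?_) (ae_of_all _ fun x => ?_)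
    · exact (SimpleFunc.nearestPt (TopologicalSpace.denseSeq E) N).measurable.aestronglyMeasurable
    · refine SimpleFunc.tendsto_nearestPt ?_
      rw [(TopologicalSpace.denseRange_denseSeq E).closure_range]
      trivial
  rw [tendstoInMeasure_iff_norm] at ht
  have h1 := (ht ε hε).eventually (gt_mem_nhds (show (0 : ENNReal) < ENNReal.ofReal η by simpa using hη))
  obtain ⟨N, hN⟩ := h1.exists
  refine ⟨SimpleFunc.nearestPt (TopologicalSpace.denseSeq E) N, ?_⟩
  refine ENNReal.toReal_le_of_le_ofReal hη.le (le_trans (measure_mono fun x hx => ?_) hN.le)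
  exact le_of_lt (show ε < _ from hx)

variable {Ω : Type*} [MeasurableSpace Ω] {μ : Measure Ω} [IsProbabilityMeasure μ]

lemma plln_bounded (F : Measure E) [IsProbabilityMeasure F] (X : ℕ → Ω → E)
    (hX : ∀ t, Measurable (X t)) (hXF : ∀ t, μ.map (X t) = F)
    (hL : ∀ (α : E → ℝ) (K : ℝ), Measurable α → (∀ x, |α x| ≤ K) →
      ULLN μ (fun t ω => α (X t ω)) (∫ x, α x ∂F))
    (h : E → E → ℝ) (hh : Measurable (fun p : E × E => h p.1 p.2))
    (φ : ℝ → ℝ) (hφ0 : Tendsto φ (nhdsWithin 0 (Set.Ioi 0)) (nhds 0))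
    (hcont : ∀ s t : ℕ, 1 ≤ s → s < t → ∀ ε : ℝ, 0 < ε →
      ∀ (m : Measure ((E × E) × (E × E))) (_ : IsProbabilityMeasure m)
      (U Ut V : (E × E) × (E × E) → E), Measurable U → Measurable Ut → Measurable V →
      m.map U = F → m.map Ut = F → m.map V = F →
      m.map (fun ω => (U ω, V ω)) = μ.map (fun ω => (X s ω, X t ω)) →
      ∫ ω, |h (U ω) (V ω) - h (Ut ω) (V ω)| * (if ‖U ω - Ut ω‖ ≤ ε then (1:ℝ) else 0) ∂m ≤ φ ε)
    (ψ : ℝ → ℝ) (hψ : ∀ x y, |ψ x - ψ y| ≤ |x - y|) (K : ℝ) (hK : ∀ x, |ψ x| ≤ K) :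
    PLLN μ X (fun x y => ψ (h x y)) (∫ p, ψ (h p.1 p.2) ∂(F.prod F)) := by
  have hK0 : 0 ≤ K := (abs_nonneg _).trans (hK 0)
  have hψm : Measurable ψ := by
    have : LipschitzWith 1 ψ := LipschitzWith.mk_one fun x y => by
      rw [Real.dist_eq, Real.dist_eq]; exact hψ x y
    exact this.continuous.measurable
  have hH : Measurable (fun p : E × E => ψ (h p.1 p.2)) := hψm.comp hh
  have hpair : ∀ s t, Measurable (fun ω => (X s ω, X t ω)) := fun s t => (hX s).prodMk (hX t)
  refine PLLN.closure (fun s t _ _ => ?_) fun η hη => ?_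
  · exact Integrable.of_bound (hH.comp (hpair s t)).aestronglyMeasurable K
      (ae_of_all _ fun ω => hK _)
  obtain ⟨ε, hε, hφε⟩ : ∃ ε : ℝ, 0 < ε ∧ φ ε ≤ η / 2 := by
    have h1 := hφ0.eventually (gt_mem_nhds (show (0 : ℝ) < η / 2 by positivity))
    obtain ⟨ε, h2, h3⟩ := (h1.and self_mem_nhdsWithin).exists
    exact ⟨ε, h3, h2.le⟩
  obtain ⟨c, hc⟩ := exists_simple_approx F (ε / 2) (η / (8 * (K + 1))) (by positivity)
    (by positivity)
  have hind : ∀ y, Measurable ((c ⁻¹' {y}).indicator (fun _ => (1 : ℝ))) := fun y =>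
    measurable_const.indicator (c.measurableSet_preimage _)
  have hindb : ∀ y x, |(c ⁻¹' {y}).indicator (fun _ => (1 : ℝ)) x| ≤ 1 := by
    intro y x
    by_cases hx : x ∈ c ⁻¹' {y}
    · rw [Set.indicator_of_mem hx]; simp
    · rw [Set.indicator_of_notMem hx]; simp
  let k : E → E → E → ℝ := fun y x v =>
    (F.real (c ⁻¹' {y}))⁻¹ * (c ⁻¹' {y}).indicator (fun _ => (1 : ℝ)) x * ψ (h x v)
  have hkm : ∀ y, Measurable (fun p : E × E => k y p.1 p.2) := fun y =>
    (((hind y).comp measurable_fst).const_mul _).mul hH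
  have hkb : ∀ y x v, |k y x v| ≤ (F.real (c ⁻¹' {y}))⁻¹ * K := by
    intro y x v
    have h0 : 0 ≤ (F.real (c ⁻¹' {y}))⁻¹ := by positivity
    simp only [k, abs_mul, abs_of_nonneg h0]
    calc (F.real (c ⁻¹' {y}))⁻¹ * |(c ⁻¹' {y}).indicator (fun _ => (1 : ℝ)) x| * |ψ (h x v)|
        ≤ (F.real (c ⁻¹' {y}))⁻¹ * 1 * K := by gcongr; exacts [hindb y x, hK _]
      _ = _ := by ring
  let g : E → E → ℝ := fun y v => ∫ x, k y x v ∂F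
  have hgm : ∀ y, Measurable (g y) := fun y =>
    (StronglyMeasurable.integral_prod_left (f := fun x v => k y x v)
      (hkm y).stronglyMeasurable).measurable
  have hgb : ∀ y v, |g y v| ≤ (F.real (c ⁻¹' {y}))⁻¹ * K := by
    intro y v
    have := norm_integral_le_of_norm_le_const (μ := F) (f := fun x => k y x v)
      (ae_of_all _ fun x => hkb y x v)
    simpa using this
  have hθ : ∫ p, ψ (h p.1 p.2) ∂(F.prod F) = ∑ y ∈ c.range,
      (∫ x, (c ⁻¹' {y}).indicator (fun _ => (1 : ℝ)) x ∂F) * ∫ v, g y v ∂F := by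
    have e1 : ∀ y, (∫ x, (c ⁻¹' {y}).indicator (fun _ => (1 : ℝ)) x ∂F) * ∫ v, g y v ∂F
        = ∫ p, (c ⁻¹' {y}).indicator (fun _ => (1 : ℝ)) p.1 * ψ (h p.1 p.2) ∂(F.prod F) := by
      intro y
      have i1 : Integrable (fun p : E × E => k y p.1 p.2) (F.prod F) :=
        Integrable.of_bound (hkm y).aestronglyMeasurable _ (ae_of_all _ fun p => hkb y p.1 p.2)
      have e2 : ∫ v, g y v ∂F = ∫ p, k y p.1 p.2 ∂(F.prod F) := (integral_prod_symm _ i1).symm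
      rw [e2, integral_indicator (c.measurableSet_preimage _)]
      simp only [k, mul_assoc, integral_const_mul]
      by_cases hy : F.real (c ⁻¹' {y}) = 0
      · have h0 : F (c ⁻¹' {y}) = 0 := by
          simpa [Measure.real, ENNReal.toReal_eq_zero_iff] using hy
        rw [hy]
        simp only [inv_zero, zero_mul, mul_zero]
        symm
        refine integral_eq_zero_of_ae ?_
        have h3 : ∀ᵐ p ∂(F.prod F), p.1 ∉ c ⁻¹' {y} :=
          Measure.quasiMeasurePreserving_fst.ae (measure_eq_zero_iff_ae_notMem.1 h0)
        filter_upwards [h3] with p hp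
        rw [Set.indicator_of_notMem hp]; simp
      · simp only [integral_const, smul_eq_mul, mul_one, measureReal_restrict_apply_univ]
        rw [mul_inv_cancel_left₀ hy]
    simp_rw [e1]
    rw [← integral_finsetSum]
    · congr 1
      ext p
      rw [← Finset.sum_mul, Finset.sum_eq_single (c p.1)]
      · simp
      · intro y _ hy
        exact Set.indicator_of_notMem (fun hm => hy (by simpa using hm.symm)) _
      · intro hn; exact absurd (c.mem_range_self _) hn
    · intro y _
      refine Integrable.of_bound (((hind y).comp measurable_fst).mul hH).aestronglyMeasurable
        (1 * K) (ae_of_all _ fun p => ?_)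
      rw [Real.norm_eq_abs, abs_mul]
      exact mul_le_mul (hindb _ _) (hK _) (abs_nonneg _) zero_le_one
  have hGm : ∀ y, Measurable (fun p : E × E =>
      (c ⁻¹' {y}).indicator (fun _ => (1 : ℝ)) p.1 * g y p.2) := fun y =>
    ((hind y).comp measurable_fst).mul ((hgm y).comp measurable_snd)
  have hGi : ∀ y s t, Integrable (fun ω =>
      (c ⁻¹' {y}).indicator (fun _ => (1 : ℝ)) (X s ω) * g y (X t ω)) μ := by
    intro y s t
    refine Integrable.of_bound ((hGm y).comp (hpair s t)).aestronglyMeasurable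
      (1 * ((F.real (c ⁻¹' {y}))⁻¹ * K)) (ae_of_all _ fun ω => ?_)
    rw [Real.norm_eq_abs, abs_mul]
    exact mul_le_mul (hindb _ _) (hgb _ _) (abs_nonneg _) zero_le_one
  refine ⟨fun u v => ∑ y ∈ c.range, (c ⁻¹' {y}).indicator (fun _ => (1 : ℝ)) u * g y v,
    ∑ y ∈ c.range, (∫ x, (c ⁻¹' {y}).indicator (fun _ => (1 : ℝ)) x ∂F) * ∫ v, g y v ∂F,
    ?_, ?_, ?_, ?_⟩
  · intro s t _ _
    exact integrable_finsetSum _ fun y _ => hGi y s t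
  · intro s t hs hst
    have hcell : ∀ u v, ∑ y ∈ c.range, (c ⁻¹' {y}).indicator (fun _ => (1 : ℝ)) u * g y v
        = ∫ x, cellW F c u x * ψ (h x v) ∂F := by
      intro u v
      simp only [g, ← integral_const_mul]
      rw [← integral_finsetSum]
      · congr 1
        ext x
        rw [cellW_eq_sum, Finset.sum_mul]
        exact Finset.sum_congr rfl fun y _ => by simp only [k]; ring
      · intro y _
        refine Integrable.const_mul ?_ _
        exact Integrable.of_bound ((hkm y).comp (measurable_id.prodMk
          measurable_const)).aestronglyMeasurable _ (ae_of_all _ fun x => hkb y x v)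
    have : IsProbabilityMeasure (μ.map (fun ω => (X s ω, X t ω))) :=
      Measure.isProbabilityMeasure_map (hpair s t).aemeasurable
    have hcb := coupling_bound F (μ.map (fun ω => (X s ω, X t ω)))
      (by rw [Measure.map_map measurable_fst (hpair s t)]; exact hXF s)
      (by rw [Measure.map_map measurable_snd (hpair s t)]; exact hXF t)
      h hh (φ ε) ε c (fun m hm U Ut V h1 h2 h3 h4 h5 h6 h7 =>
        hcont s t hs hst ε hε m hm U Ut V h1 h2 h3 h4 h5 h6 h7) ψ hψ K hK
    simp only [← hcell] at hcb
    rw [integral_map (hpair s t).aemeasurable] at hcb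
    · refine hcb.trans ?_
      have h1 : 4 * K * F.real {x | ε / 2 < ‖c x - x‖} ≤ 4 * K * (η / (8 * (K + 1))) := by
        gcongr
      have h2 : 4 * K * (η / (8 * (K + 1))) ≤ η / 2 := by
        rw [← mul_div_assoc, div_le_div_iff₀ (by positivity) (by norm_num)]
        nlinarith
      linarith
    · exact (measurable_abs.comp (hH.sub (Finset.measurable_sum _ fun y _ =>
        hGm y))).aestronglyMeasurable
  · rw [hθ]; simpa using hη.le
  · refine PLLN.finset_sum c.range (fun y _ s t _ _ => hGi y s t) fun y _ => ?_
    have hmax : ∀ x, |(c ⁻¹' {y}).indicator (fun _ => (1 : ℝ)) x|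
        ≤ max 1 ((F.real (c ⁻¹' {y}))⁻¹ * K) := fun x => (hindb y x).trans (le_max_left _ _)
    refine PLLN.mul (K := max 1 ((F.real (c ⁻¹' {y}))⁻¹ * K)) hX (hind y) (hgm y) hmax
      (fun v => (hgb y v).trans (le_max_right _ _)) ?_ (hL _ _ (hind y) (hindb y))
      (hL _ _ (hgm y) (hgb y))
    have := norm_integral_le_of_norm_le_const (μ := F)
      (f := (c ⁻¹' {y}).indicator (fun _ => (1 : ℝ))) (ae_of_all _ hmax)
    simpa using this

end bounded
section unbounded

variable {Ω E : Type*} [MeasurableSpace Ω] [MeasurableSpace E]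
  {μ : Measure Ω} [IsProbabilityMeasure μ] {X : ℕ → Ω → E}

lemma PLLN.mean_le {G : E → E → ℝ} {θ η : ℝ} (hP : PLLN μ X G θ)
    (hG : ∀ s t, 1 ≤ s → s < t → Integrable (fun ω => G (X s ω) (X t ω)) μ)
    (hη : ∀ s t, 1 ≤ s → s < t → ∫ ω, G (X s ω) (X t ω) ∂μ ≤ η) : θ ≤ η := by
  refine le_of_forall_pos_le_add fun δ hδ => ?_
  obtain ⟨N, hN⟩ := hP (δ / 4) (by positivity)
  have h1 := hN (N + 2) (by omega)
  set n := N + 2 with hn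
  have hn2 : (2 : ℝ) ≤ n := by rw [hn]; push_cast; linarith [(Nat.cast_nonneg N : (0:ℝ) ≤ N)]
  have hc := card_pairs n
  have h2 : (pairs n).card * (θ - η) ≤ ∫ ω, |∑ p ∈ pairs n, (G (X p.1 ω) (X p.2 ω) - θ)| ∂μ := by
    have i1 := pairs_integrable hG θ n
    have h3 : -∫ ω, ∑ p ∈ pairs n, (G (X p.1 ω) (X p.2 ω) - θ) ∂μ
        ≤ ∫ ω, |∑ p ∈ pairs n, (G (X p.1 ω) (X p.2 ω) - θ)| ∂μ :=
      (neg_le_abs _).trans abs_integral_le_integral_abs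
    refine le_trans ?_ h3
    rw [integral_finsetSum]
    · have h4 : ∑ p ∈ pairs n, ∫ ω, (G (X p.1 ω) (X p.2 ω) - θ) ∂μ ≤ (pairs n).card • (η - θ) := by
        refine Finset.sum_le_card_nsmul _ _ _ fun p hp => ?_
        have := mem_pairs hp
        rw [integral_sub (hG _ _ this.1 this.2.1) (integrable_const _)]
        have := hη _ _ this.1 this.2.1
        simpa using this
      rw [nsmul_eq_mul] at h4
      linarith
    · intro p hp
      have := mem_pairs hp
      exact (hG _ _ this.1 this.2.1).sub (integrable_const _)
  have h3 : (n : ℝ) ^ 2 ≤ 4 * (pairs n).card := by nlinarith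
  have hpos : (0 : ℝ) < (pairs n).card := by nlinarith
  have h4 : (pairs n).card * (θ - η) ≤ (pairs n).card * δ := by
    nlinarith
  have := le_of_mul_le_mul_left h4 hpos
  linarith

/-- truncation at level `C` -/
def clip (C x : ℝ) : ℝ := max (-C) (min x C)

lemma clip_lip (C x y : ℝ) : |clip C x - clip C y| ≤ |x - y| := by
  unfold clip
  rw [max_comm (-C), max_comm (-C)]
  refine (abs_max_sub_max_le_abs (min x C) (min y C) (-C)).trans ?_
  exact (abs_min_sub_min_le_max x C y C).trans (by simp)

lemma clip_bdd (C x : ℝ) (hC : 0 ≤ C) : |clip C x| ≤ C := by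
  unfold clip
  rw [abs_le]
  exact ⟨le_max_left _ _, max_le (by linarith) (min_le_right _ _)⟩

lemma clip_res_lip (C x y : ℝ) : |(|x - clip C x|) - (|y - clip C y|)| ≤ |x - y| := by
  refine (abs_abs_sub_abs_le _ _).trans ?_
  unfold clip
  rcases le_total x y with h | h
  · rw [abs_of_nonpos (sub_nonpos.2 h)]
    rw [abs_le]
    constructor <;>
    · rcases le_total x C with h1 | h1 <;> rcases le_total y C with h2 | h2 <;>
        simp only [min_eq_left, min_eq_right, h1, h2] <;>
        rcases max_cases (-C) x with h3 | h3 <;> rcases max_cases (-C) y with h4 | h4 <;>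
        rcases max_cases (-C) C with h5 | h5 <;> linarith
  · rw [abs_of_nonneg (sub_nonneg.2 h)]
    rw [abs_le]
    constructor <;>
    · rcases le_total x C with h1 | h1 <;> rcases le_total y C with h2 | h2 <;>
        simp only [min_eq_left, min_eq_right, h1, h2] <;>
        rcases max_cases (-C) x with h3 | h3 <;> rcases max_cases (-C) y with h4 | h4 <;>
        rcases max_cases (-C) C with h5 | h5 <;> linarith

lemma clip_measurable (C : ℝ) : Measurable (clip C) := by
  unfold clip; fun_prop

lemma plln_unbounded (F : Measure E) [IsProbabilityMeasure F]
    (hX : ∀ t, Measurable (X t)) (h : E → E → ℝ) (hh : Measurable (fun p : E × E => h p.1 p.2))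
    (hb : ∀ (ψ : ℝ → ℝ) (K : ℝ), (∀ x y, |ψ x - ψ y| ≤ |x - y|) → (∀ x, |ψ x| ≤ K) →
      PLLN μ X (fun x y => ψ (h x y)) (∫ p, ψ (h p.1 p.2) ∂(F.prod F)))
    (hint : ∀ s t, 1 ≤ s → s < t → Integrable (fun ω => h (X s ω) (X t ω)) μ)
    (htr : ∀ η : ℝ, 0 < η → ∃ C : ℝ, 0 ≤ C ∧ ∀ s t, 1 ≤ s → s < t →
      ∫ ω, |h (X s ω) (X t ω) - clip C (h (X s ω) (X t ω))| ∂μ ≤ η) :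
    Integrable (fun p : E × E => h p.1 p.2) (F.prod F) ∧
      PLLN μ X h (∫ p, h p.1 p.2 ∂(F.prod F)) := by
  have hpair : ∀ s t, Measurable (fun ω => (X s ω, X t ω)) := fun s t => (hX s).prodMk (hX t)
  have hcm : ∀ C, Measurable (fun p : E × E => clip C (h p.1 p.2)) := fun C =>
    (clip_measurable C).comp hh
  have hci : ∀ C, 0 ≤ C → Integrable (fun p : E × E => clip C (h p.1 p.2)) (F.prod F) :=
    fun C hC => Integrable.of_bound (hcm C).aestronglyMeasurable C
      (ae_of_all _ fun p => clip_bdd C _ hC)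
  have hcX : ∀ C, 0 ≤ C → ∀ s t, Integrable (fun ω => clip C (h (X s ω) (X t ω))) μ :=
    fun C hC s t => Integrable.of_bound ((hcm C).comp (hpair s t)).aestronglyMeasurable C
      (ae_of_all _ fun p => clip_bdd C _ hC)
  have key : ∀ η C : ℝ, 0 < η → 0 ≤ C → (∀ s t, 1 ≤ s → s < t →
      ∫ ω, |h (X s ω) (X t ω) - clip C (h (X s ω) (X t ω))| ∂μ ≤ η) →
      Integrable (fun p : E × E => h p.1 p.2) (F.prod F) ∧
      ∫ p, |h p.1 p.2 - clip C (h p.1 p.2)| ∂(F.prod F) ≤ η := by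
    intro η C hη hC hCs
    have hrm : Measurable (fun p : E × E => |h p.1 p.2 - clip C (h p.1 p.2)|) :=
      measurable_abs.comp (hh.sub (hcm C))
    have hL : ∀ L : ℕ, ∫ p, min (|h p.1 p.2 - clip C (h p.1 p.2)|) L ∂(F.prod F) ≤ η := by
      intro L
      have hbd : ∀ x, |min (|x - clip C x|) (L : ℝ)| ≤ L := fun x => by
        rw [abs_of_nonneg (le_min (abs_nonneg _) (Nat.cast_nonneg _))]
        exact min_le_right _ _
      have hi : ∀ s t, 1 ≤ s → s < t → Integrable
          (fun ω => min (|h (X s ω) (X t ω) - clip C (h (X s ω) (X t ω))|) (L : ℝ)) μ :=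
        fun s t _ _ => Integrable.of_bound
          ((hrm.comp (hpair s t)).min measurable_const).aestronglyMeasurable L
          (ae_of_all _ fun ω => hbd _)
      refine PLLN.mean_le (hb (fun x => min (|x - clip C x|) (L : ℝ)) L (fun x y => ?_) hbd) hi ?_
      · refine (abs_min_sub_min_le_max _ _ _ _).trans ?_
        simpa using clip_res_lip C x y
      · intro s t hs hst
        refine (integral_mono (hi s t hs hst) ((hint s t hs hst).sub (hcX C hC s t)).abs
          fun ω => min_le_left _ _).trans (hCs s t hs hst)
    have hlin : ∫⁻ p, ENNReal.ofReal (|h p.1 p.2 - clip C (h p.1 p.2)|) ∂(F.prod F)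
        ≤ ENNReal.ofReal η := by
      have e : ∀ p : E × E, ENNReal.ofReal (|h p.1 p.2 - clip C (h p.1 p.2)|)
          = ⨆ L : ℕ, ENNReal.ofReal (min (|h p.1 p.2 - clip C (h p.1 p.2)|) L) := by
        intro p
        refine le_antisymm ?_ (iSup_le fun L => ENNReal.ofReal_le_ofReal (min_le_left _ _))
        obtain ⟨L, hL⟩ := exists_nat_ge (|h p.1 p.2 - clip C (h p.1 p.2)|)
        refine le_iSup_of_le L ?_
        rw [min_eq_left hL]
      simp_rw [e]
      rw [lintegral_iSup]
      · refine iSup_le fun L => ?_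
        rw [← ofReal_integral_eq_lintegral_ofReal]
        · exact ENNReal.ofReal_le_ofReal (hL L)
        · refine Integrable.of_bound (hrm.min measurable_const).aestronglyMeasurable L
            (ae_of_all _ fun p => ?_)
          rw [Real.norm_eq_abs, abs_of_nonneg (le_min (abs_nonneg _) (Nat.cast_nonneg _))]
          exact min_le_right _ _
        · exact ae_of_all _ fun p => le_min (abs_nonneg _) (Nat.cast_nonneg _)
      · exact fun L => (hrm.min measurable_const).ennreal_ofReal
      · intro L M hLM p
        refine ENNReal.ofReal_le_ofReal (min_le_min le_rfl ?_)
        exact_mod_cast hLM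
    have hri : Integrable (fun p : E × E => h p.1 p.2 - clip C (h p.1 p.2)) (F.prod F) := by
      refine ⟨(hh.sub (hcm C)).aestronglyMeasurable, ?_⟩
      rw [hasFiniteIntegral_iff_norm]
      exact hlin.trans_lt ENNReal.ofReal_lt_top
    refine ⟨?_, ?_⟩
    · have := hri.add (hci C hC)
      refine this.congr (ae_of_all _ fun p => ?_)
      simp
    · rw [integral_eq_lintegral_of_nonneg_ae (ae_of_all _ fun p => abs_nonneg _)
        hrm.aestronglyMeasurable]
      exact ENNReal.toReal_le_of_le_ofReal hη.le hlin
  have hI : Integrable (fun p : E × E => h p.1 p.2) (F.prod F) := by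
    obtain ⟨C, hC, hCs⟩ := htr 1 one_pos
    exact (key 1 C one_pos hC hCs).1
  refine ⟨hI, PLLN.closure hint fun η hη => ?_⟩
  obtain ⟨C, hC, hCs⟩ := htr η hη
  refine ⟨fun x y => clip C (h x y), ∫ p, clip C (h p.1 p.2) ∂(F.prod F),
    fun s t _ _ => hcX C hC s t, hCs, ?_, hb (clip C) C (clip_lip C) fun x => clip_bdd C x hC⟩
  rw [← integral_sub hI (hci C hC)]
  exact abs_integral_le_integral_abs.trans (key η C hη hC hCs).2

end unbounded
/-- law of large numbers for U-statistics of 1-approximating functionals: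
If `(X_t)` is a 1-approximating functional of a stationary absolutely regular process with
`Σ_{k≥d} a_k < ∞`, `h` measurable symmetric and 1-continuous (with modulus `φ`), and the
family `{h(X_s, X_t)}` uniformly integrable, then `U_n(h) →P θ = ∫∫ h dF dF`. -/
theorem stmt_16 {Ω : Type*} [MeasurableSpace Ω] (μ : Measure Ω) [IsProbabilityMeasure μ]
    (Z : ℤ → Ω → ℝ) (hZmeas : ∀ t, Measurable (Z t)) (hstat : Stationary μ Z)
    (hreg : Tendsto (betaMix μ Z) atTop (nhds 0))
    (d : ℕ)
    (f : (ℤ → ℝ) → (Fin d → ℝ)) (hf : Measurable f)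
    (X : ℤ → Ω → (Fin d → ℝ)) (hX : ∀ t ω, X t ω = f (fun k => Z (t + k) ω))
    (a : ℕ → ℝ) (ha0 : Tendsto a atTop (nhds 0))
    (happrox : ∀ k : ℕ,
      ∫ ω, ‖X 0 ω - (μ[X 0 | sigmaIcc Z (-(k : ℤ)) (k : ℤ)]) ω‖ ∂μ ≤ a k)
    (dsum : ℕ) (hsum : Summable (fun k : ℕ => a (dsum + k)))
    (h : (Fin d → ℝ) → (Fin d → ℝ) → ℝ)
    (hhmeas : Measurable (fun p : (Fin d → ℝ) × (Fin d → ℝ) => h p.1 p.2))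
    (hhsymm : ∀ x y, h x y = h y x)
    (φ : ℝ → ℝ) (hφ0 : Tendsto φ (nhdsWithin 0 (Set.Ioi 0)) (nhds 0))
    (hhcont : ∀ (Ω' : Type) (_ : MeasurableSpace Ω') (μ' : Measure Ω')
        (_ : IsProbabilityMeasure μ') (U Ut V : Ω' → (Fin d → ℝ)),
        Measurable U → Measurable Ut → Measurable V →
        Measure.map U μ' = Measure.map (X 0) μ →
        Measure.map Ut μ' = Measure.map (X 0) μ →
        Measure.map V μ' = Measure.map (X 0) μ →
        ((Measure.map (fun ω => (U ω, V ω)) μ'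
            = (Measure.map (X 0) μ).prod (Measure.map (X 0) μ))
          ∨ (∃ t : ℤ, 1 ≤ t ∧ Measure.map (fun ω => (U ω, V ω)) μ'
              = Measure.map (fun ω => (X 0 ω, X t ω)) μ)) →
        ∀ ε : ℝ, 0 < ε →
          ∫ ω, |h (U ω) (V ω) - h (Ut ω) (V ω)|
              * (if ‖U ω - Ut ω‖ ≤ ε then (1 : ℝ) else 0) ∂μ' ≤ φ ε)
    (hUI : UniformIntegrable
      (fun st : ℕ × ℕ => fun ω => h (X ((st.1 : ℤ) + 1) ω) (X ((st.2 : ℤ) + 1) ω)) 1 μ) :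
    TendstoInMeasure μ
      (fun (n : ℕ) ω => (1 / ((n : ℝ) * ((n : ℝ) - 1))) *
        ∑ s ∈ Finset.Icc 1 n, ∑ t ∈ Finset.Icc 1 n,
          if s ≠ t then h (X (s : ℤ) ω) (X (t : ℤ) ω) else 0)
      atTop
      (fun _ => ∫ x, ∫ y, h x y ∂(Measure.map (X 0) μ) ∂(Measure.map (X 0) μ)) := by
  have hXm : ∀ t, Measurable (X t) := fun t => by
    have : X t = fun ω => f (fun k => Z (t + k) ω) := funext (hX t)
    rw [this]
    exact hf.comp (measurable_pi_lambda _ fun k => hZmeas _)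
  have hpath0 : Measurable (fun ω => fun k : ℤ => Z k ω) := measurable_pi_lambda _ fun k => hZmeas _
  have hpath : ∀ j : ℤ, Measurable (fun ω => fun k : ℤ => Z (j + k) ω) := fun j =>
    measurable_pi_lambda _ fun k => hZmeas _
  have hst : ∀ j : ℤ, μ.map (fun ω => fun k : ℤ => Z (j + k) ω) = μ.map (fun ω k => Z k ω) := by
    intro j
    rw [← hstat j]
    simp_rw [add_comm j]
  -- laws of single variables and pairs
  have hlaw : ∀ t, μ.map (X t) = (μ.map (fun ω k => Z k ω)).map f := by
    intro t
    rw [← hst t, Measure.map_map hf (hpath t)]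
    congr 1
    exact funext (hX t)
  have hlaw0 : ∀ t, μ.map (X t) = μ.map (X 0) := fun t => by rw [hlaw t, hlaw 0]
  have hpairlaw : ∀ s t : ℤ, μ.map (fun ω => (X s ω, X t ω))
      = μ.map (fun ω => (X 0 ω, X (t - s) ω)) := by
    have key : ∀ s r : ℤ, μ.map (fun ω => (X s ω, X (s + r) ω))
        = (μ.map (fun ω k => Z k ω)).map
          (fun z : ℤ → ℝ => (f z, f (fun k => z (r + k)))) := by
      intro s r
      have hm : Measurable (fun z : ℤ → ℝ => (f z, f (fun k => z (r + k)))) :=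
        hf.prodMk (hf.comp (measurable_pi_lambda _ fun k => measurable_pi_apply _))
      rw [← hst s, Measure.map_map hm (hpath s)]
      congr 1
      ext1 ω
      simp only [Function.comp, hX, add_assoc]
    intro s t
    have k1 := key s (t - s)
    have k2 := key 0 (t - s)
    rw [show s + (t - s) = t by ring] at k1
    rw [zero_add] at k2
    rw [k1, k2]
  have hprob : IsProbabilityMeasure (μ.map (X 0)) :=
    Measure.isProbabilityMeasure_map (hXm 0).aemeasurable
  have hprobZ : IsProbabilityMeasure (μ.map (fun ω k => Z k ω)) :=
    Measure.isProbabilityMeasure_map hpath0.aemeasurable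
  have hL : ∀ (α : (Fin d → ℝ) → ℝ) (K : ℝ), Measurable α → (∀ x, |α x| ≤ K) →
      ULLN μ (fun (t : ℕ) ω => α (X (t : ℤ) ω)) (∫ x, α x ∂(μ.map (X 0))) := by
    intro α K hα hαK
    have hi : Integrable (fun z => α (f z)) (μ.map (fun ω k => Z k ω)) :=
      Integrable.of_bound (hα.comp hf).aestronglyMeasurable K (ae_of_all _ fun z => hαK _)
    have := flln_of_mixing μ Z hZmeas hstat hreg (fun z => α (f z)) hi
    unfold FLLN at this
    rw [hlaw 0, integral_map hf.aemeasurable hα.aestronglyMeasurable]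
    simp only [hX]
    exact this
  have hpm : ∀ s t : ℤ, Measurable (fun ω => (X s ω, X t ω)) := fun s t =>
    (hXm s).prodMk (hXm t)
  have hidx : ∀ s t : ℕ, 1 ≤ s → 1 ≤ t → (fun ω => h (X (s : ℤ) ω) (X (t : ℤ) ω))
      = (fun st : ℕ × ℕ => fun ω => h (X ((st.1 : ℤ) + 1) ω) (X ((st.2 : ℤ) + 1) ω))
        (s - 1, t - 1) := by
    intro s t hs ht
    ext ω
    simp only [Nat.cast_sub hs, Nat.cast_sub ht, Nat.cast_one, sub_add_cancel]
  have hint : ∀ s t : ℕ, 1 ≤ s → s < t →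
      Integrable (fun ω => h (X (s : ℤ) ω) (X (t : ℤ) ω)) μ := by
    intro s t hs hst'
    rw [hidx s t hs (by omega)]
    exact memLp_one_iff_integrable.1 (hUI.memLp _)
  obtain ⟨hI, hP⟩ := plln_unbounded (μ := μ) (X := fun (t : ℕ) => X (t : ℤ)) (μ.map (X 0))
    (fun t => hXm t) h hhmeas
    (fun ψ K hψ hK => plln_bounded (μ.map (X 0)) (fun (t : ℕ) => X (t : ℤ)) (fun t => hXm t)
      (fun t => hlaw0 t) hL h hhmeas φ hφ0
      (fun s t hs hst' ε hε m hm U Ut V h1 h2 h3 h4 h5 h6 h7 =>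
        hhcont _ _ m hm U Ut V h1 h2 h3 h4 h5 h6
          (Or.inr ⟨(t : ℤ) - s, by omega, h7.trans (hpairlaw s t)⟩) ε hε) ψ hψ K hK)
    hint (by
      intro η hη
      obtain ⟨C, hC⟩ := hUI.spec one_ne_zero ENNReal.one_ne_top hη
      refine ⟨C, C.2, fun s t hs hst' => ?_⟩
      have h1 := hC (s - 1, t - 1)
      simp only [Nat.cast_sub hs, Nat.cast_sub (show 1 ≤ t by omega), Nat.cast_one,
        sub_add_cancel] at h1
      rw [eLpNorm_one_eq_lintegral_enorm] at h1
      have hm : Measurable (fun ω => h (X (s : ℤ) ω) (X (t : ℤ) ω)) := hhmeas.comp (hpm s t)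
      have hm2 : Measurable (fun ω => |h (X (s : ℤ) ω) (X (t : ℤ) ω)
          - clip C (h (X (s : ℤ) ω) (X (t : ℤ) ω))|) :=
        measurable_abs.comp (hm.sub ((clip_measurable C).comp hm))
      rw [integral_eq_lintegral_of_nonneg_ae (ae_of_all _ fun p => abs_nonneg _)
        hm2.aestronglyMeasurable]
      refine ENNReal.toReal_le_of_le_ofReal hη.le (le_trans (lintegral_mono fun ω => ?_) h1)
      rw [← ofReal_norm_eq_enorm]
      refine ENNReal.ofReal_le_ofReal ?_
      by_cases hω : (C : ℝ) ≤ |h (X (s : ℤ) ω) (X (t : ℤ) ω)|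
      · rw [Set.indicator_of_mem (show ω ∈ {x | C ≤ ‖h (X (s : ℤ) x) (X (t : ℤ) x)‖₊} from hω),
          Real.norm_eq_abs]
        have hC0 : (0 : ℝ) ≤ C := C.2
        unfold clip
        generalize h (X (s : ℤ) ω) (X (t : ℤ) ω) = x at *
        rcases le_total x 0 with hx | hx
        · rw [abs_of_nonpos hx] at hω ⊢
          rw [min_eq_left (by linarith), max_eq_left (by linarith), abs_le]
          constructor <;> linarith
        · rw [abs_of_nonneg hx] at hω ⊢
          rw [min_eq_right (by linarith), max_eq_right (by linarith), abs_le]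
          constructor <;> linarith
      · have : clip C (h (X (s : ℤ) ω) (X (t : ℤ) ω)) = h (X (s : ℤ) ω) (X (t : ℤ) ω) := by
          push Not at hω
          have := abs_lt.1 hω
          unfold clip
          rw [min_eq_left this.2.le, max_eq_right this.1.le]
        rw [this]
        simp)
  rw [← integral_prod (fun p : (Fin d → ℝ) × (Fin d → ℝ) => h p.1 p.2) hI]
  set θ := ∫ p, h p.1 p.2 ∂((μ.map (X 0)).prod (μ.map (X 0))) with hθ
  have hUm : ∀ n : ℕ, Measurable (fun ω => (1 / ((n : ℝ) * ((n : ℝ) - 1))) *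
        ∑ s ∈ Finset.Icc 1 n, ∑ t ∈ Finset.Icc 1 n,
          if s ≠ t then h (X (s : ℤ) ω) (X (t : ℤ) ω) else 0) := by
    intro n
    refine Measurable.const_mul (Finset.measurable_sum _ fun s _ =>
      Finset.measurable_sum _ fun t _ => ?_) _
    by_cases hst' : s = t
    · simp [hst']
    · simp only [ne_eq, hst', not_false_eq_true, if_true]
      exact hhmeas.comp (hpm s t)
  refine tendstoInMeasure_of_tendsto_eLpNorm (p := 1) one_ne_zero
    (fun n => (hUm n).aestronglyMeasurable) aestronglyMeasurable_const ?_
  have hid : ∀ n : ℕ, 2 ≤ n → ∀ ω, ((1 / ((n : ℝ) * ((n : ℝ) - 1))) *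
        ∑ s ∈ Finset.Icc 1 n, ∑ t ∈ Finset.Icc 1 n,
          if s ≠ t then h (X (s : ℤ) ω) (X (t : ℤ) ω) else 0) - θ
        = (2 / ((n : ℝ) * ((n : ℝ) - 1))) *
          ∑ p ∈ pairs n, (h (X (p.1 : ℤ) ω) (X (p.2 : ℤ) ω) - θ) := by
    intro n hn ω
    have hn2 : (2 : ℝ) ≤ n := by exact_mod_cast hn
    rw [sum_offdiag n (fun s t => h (X (s : ℤ) ω) (X (t : ℤ) ω)) (fun s t => hhsymm _ _),
      Finset.sum_sub_distrib, Finset.sum_const, nsmul_eq_mul]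
    have hc := card_pairs n
    have h1 : (n : ℝ) ≠ 0 := by linarith
    have h2 : (n : ℝ) - 1 ≠ 0 := by linarith
    have hc' : ((pairs n).card : ℝ) = (n : ℝ) * ((n : ℝ) - 1) / 2 := by linarith
    rw [hc']
    field_simp
  rw [ENNReal.tendsto_atTop_zero]
  intro e he
  obtain ⟨δ, hδ, hδe⟩ : ∃ δ : ℝ, 0 < δ ∧ ENNReal.ofReal δ ≤ e := by
    rcases eq_or_ne e ⊤ with rfl | htop
    · exact ⟨1, one_pos, le_top⟩
    · exact ⟨e.toReal, ENNReal.toReal_pos he.ne' htop, by rw [ENNReal.ofReal_toReal htop]⟩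
  obtain ⟨N, hN⟩ := hP (δ / 4) (by positivity)
  refine ⟨max N 2, fun n hn => le_trans ?_ hδe⟩
  have hn2 : 2 ≤ n := le_of_max_le_right hn
  have hn2' : (2 : ℝ) ≤ n := by exact_mod_cast hn2
  have hb := hN n (le_of_max_le_left hn)
  have hPi := pairs_integrable (X := fun (t : ℕ) => X (t : ℤ)) hint θ n
  rw [eLpNorm_one_eq_lintegral_enorm]
  have hpos : 0 < (n : ℝ) * ((n : ℝ) - 1) := by nlinarith
  have heq : ∀ ω, ‖((fun ω => (1 / ((n : ℝ) * ((n : ℝ) - 1))) *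
        ∑ s ∈ Finset.Icc 1 n, ∑ t ∈ Finset.Icc 1 n,
          if s ≠ t then h (X (s : ℤ) ω) (X (t : ℤ) ω) else 0) - (fun _ => θ) : Ω → ℝ) ω‖ₑ
      = ENNReal.ofReal ((2 / ((n : ℝ) * ((n : ℝ) - 1))) *
          |∑ p ∈ pairs n, (h (X (p.1 : ℤ) ω) (X (p.2 : ℤ) ω) - θ)|) := by
    intro ω
    rw [← ofReal_norm_eq_enorm, Pi.sub_apply, hid n hn2 ω, norm_mul, Real.norm_eq_abs,
      Real.norm_eq_abs, abs_of_nonneg (by positivity : 0 ≤ 2 / ((n : ℝ) * ((n : ℝ) - 1)))]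
  simp_rw [heq]
  rw [← ofReal_integral_eq_lintegral_ofReal (hPi.abs.const_mul _)
    (ae_of_all _ fun ω => by positivity), integral_const_mul]
  refine ENNReal.ofReal_le_ofReal ?_
  calc (2 / ((n : ℝ) * ((n : ℝ) - 1))) *
        ∫ ω, |∑ p ∈ pairs n, (h (X (p.1 : ℤ) ω) (X (p.2 : ℤ) ω) - θ)| ∂μ
      ≤ (2 / ((n : ℝ) * ((n : ℝ) - 1))) * (δ / 4 * (n : ℝ) ^ 2) := by gcongr
    _ ≤ δ := by
      rw [div_mul_eq_mul_div, div_le_iff₀ hpos]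
      nlinarith [mul_nonneg hδ.le (mul_nonneg (by linarith : (0:ℝ) ≤ n) (by linarith : (0:ℝ) ≤ n - 2))]
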